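/- There are infinitely many Carmichael numbers n such that the number of distinct prime factors of n is a composite number. (This statement is unconditional.) -/

import Mathlib

/-- A Carmichael number: a composite `n > 1` dividing `a^n - a` for every integer `a`. -/
def IsCarmichael (n : ℕ) : Prop :=
  1 < n ∧ ¬ n.Prime ∧ ∀ a : ℤ, (n : ℤ) ∣ a ^ n - a

namespace CInf
open Complex Filter Topology MeasureTheory Asymptotics

/-- partial sums of a character -/
noncomputable def cs {N : ℕ} (χ : DirichletCharacter ℂ N) (n : ℕ) : ℂ := ∑ k ∈ Finset.Icc 1 n, χ (k : ZMod N)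

lemma cs_le_self {N : ℕ} (χ : DirichletCharacter ℂ N) (n : ℕ) : ‖cs χ n‖ ≤ n := by
  unfold cs
  refine (norm_sum_le _ _).trans ?_
  refine (Finset.sum_le_sum (fun k _ => χ.norm_le_one _)).trans ?_
  simp

lemma cs_le_mod {N : ℕ} [NeZero N] {χ : DirichletCharacter ℂ N} (hχ : χ ≠ 1) (n : ℕ) :
    ‖cs χ n‖ ≤ N := by
  let g : ℕ → ℂ := fun n => ∑ k ∈ Finset.range n, χ ((k + 1 : ℕ) : ZMod N)
  have hg : ∀ n, cs χ n = g n := by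
    intro n
    simp only [cs, g]
    rw [Finset.range_eq_Ico, Finset.sum_Ico_add' (fun k : ℕ => χ (k : ZMod N)) 0 n 1]
    rfl
  have h0 : g N = 0 := by
    have h1 : ∑ a : ZMod N, χ (a + 1) = 0 := by
      exact (Equiv.sum_comp (Equiv.addRight (1 : ZMod N)) (fun a => χ a)).trans
        (MulChar.sum_eq_zero_of_ne_one hχ)
    rw [← h1]
    simp only [g]
    symm
    refine Finset.sum_bij (fun a _ => a.val) ?_ ?_ ?_ ?_
    · intro a _; simpa using ZMod.val_lt a
    · intro a _ b _ h; exact ZMod.val_injective N h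
    · intro b hb
      exact ⟨(b : ZMod N), Finset.mem_univ _, ZMod.val_cast_of_lt (by simpa using hb)⟩
    · intro a _; simp
  have hper : ∀ n, g (N + n) = g n := by
    intro n
    have : g (N + n) = g N + g n := by
      simp only [g]
      rw [Finset.sum_range_add]
      congr 1
      refine Finset.sum_congr rfl fun k _ => ?_
      congr 1; push_cast; simp
    rw [this, h0, zero_add]
  have hper' : ∀ q r, g (N * q + r) = g r := by
    intro q r
    induction q with
    | zero => simp
    | succ q ih => rw [show N * (q + 1) + r = N + (N * q + r) by ring, hper, ih]
  rw [hg, ← Nat.div_add_mod n N, hper', ← hg]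
  refine (cs_le_self χ _).trans ?_
  exact_mod_cast (Nat.mod_lt _ (NeZero.pos N)).le

/-- the coefficient function for the Mellin transform -/
noncomputable def cf {N : ℕ} (χ : DirichletCharacter ℂ N) (t : ℝ) : ℂ := cs χ ⌊t⌋₊

lemma cf_meas {N : ℕ} (χ : DirichletCharacter ℂ N) : Measurable (cf χ) :=
  (measurable_from_top (f := cs χ)).comp Nat.measurable_floor

lemma cf_zero {N : ℕ} (χ : DirichletCharacter ℂ N) {t : ℝ} (ht : t < 1) : cf χ t = 0 := by
  simp [cf, Nat.floor_eq_zero.mpr ht, cs]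

lemma cf_locInt {N : ℕ} [NeZero N] {χ : DirichletCharacter ℂ N} (hχ : χ ≠ 1) :
    LocallyIntegrableOn (cf χ) (Set.Ioi 0) := by
  have : LocallyIntegrable (fun _ : ℝ => (N : ℝ)) := locallyIntegrable_const _
  refine (this.mono (cf_meas χ).aestronglyMeasurable ?_).locallyIntegrableOn _
  refine Eventually.of_forall fun t => ?_
  simpa [cf, cs] using cs_le_mod hχ _

lemma cf_diff {N : ℕ} [NeZero N] {χ : DirichletCharacter ℂ N} (hχ : χ ≠ 1) {s : ℂ}
    (hs : 0 < s.re) : DifferentiableAt ℂ (fun s => s * mellin (cf χ) (-s)) s := by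
  have h : DifferentiableAt ℂ (mellin (cf χ)) (-s) := by
    refine mellin_differentiableAt_of_isBigO_rpow (a := 0) (b := (-s).re - 1) (cf_locInt hχ) ?_ (by simpa) ?_ (by linarith)
    · refine IsBigO.of_bound N (Eventually.of_forall fun t => ?_)
      simpa [cf, cs] using cs_le_mod hχ _
    · refine IsBigO.of_bound 1 ?_
      have : ∀ᶠ t : ℝ in 𝓝[>] 0, t < 1 := nhdsWithin_le_nhds (Iio_mem_nhds one_pos)
      filter_upwards [this] with t ht
      rw [cf_zero χ ht]; simp
  exact differentiableAt_id.mul (h.comp s differentiableAt_id.neg)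

lemma cf_int {N : ℕ} (χ : DirichletCharacter ℂ N) (s : ℂ) :
    ∫ t in Set.Ioi (0:ℝ), (t : ℂ) ^ (-s - 1) • cf χ t =
        ∫ t in Set.Ici (1:ℝ), (t : ℂ) ^ (-s - 1) • cf χ t := by
  refine setIntegral_eq_of_subset_of_forall_sdiff_eq_zero measurableSet_Ioi ?_ ?_
  · intro t ht; exact lt_of_lt_of_le one_pos (Set.mem_Ici.mp ht)
  · intro t ht; rw [cf_zero χ (by simpa using ht.2), smul_zero]

lemma LFunction_eq_mellin_aux {N : ℕ} [NeZero N] {χ : DirichletCharacter ℂ N} (hχ : χ ≠ 1) {s : ℂ}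
    (hs : 1 < s.re) : DirichletCharacter.LFunction χ s = s * mellin (cf χ) (-s) := by
  rw [DirichletCharacter.LFunction_eq_LSeries χ hs]
  rw [LSeries_eq_mul_integral _ (r := 0) le_rfl (by linarith)
    (DirichletCharacter.LSeriesSummable_of_one_lt_re χ hs)]
  · congr 1
    unfold mellin
    rw [cf_int, integral_Ici_eq_integral_Ioi]
    refine setIntegral_congr_fun measurableSet_Ioi fun t _ => ?_
    simp only [cf, cs, smul_eq_mul]
    rw [mul_comm]; congr 2; ring
  · refine IsBigO.of_bound N (Eventually.of_forall fun t => ?_)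
    simpa [cf, cs] using cs_le_mod hχ _

lemma LFunction_eq_mellin {N : ℕ} [NeZero N] {χ : DirichletCharacter ℂ N} (hχ : χ ≠ 1) {s : ℂ}
    (hs : 0 < s.re) : DirichletCharacter.LFunction χ s = s * mellin (cf χ) (-s) := by
  let U : Set ℂ := {s | 0 < s.re}
  have hU : IsOpen U := isOpen_lt continuous_const continuous_re
  have hUc : IsPreconnected U := (convex_halfSpace_re_gt 0).isPreconnected
  have h1 : AnalyticOnNhd ℂ (DirichletCharacter.LFunction χ) U :=
    (DirichletCharacter.differentiable_LFunction hχ).differentiableOn.analyticOnNhd hU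
  have h2 : AnalyticOnNhd ℂ (fun s => s * mellin (cf χ) (-s)) U :=
    DifferentiableOn.analyticOnNhd (fun s hs => (cf_diff hχ hs).differentiableWithinAt) hU
  refine h1.eqOn_of_preconnected_of_eventuallyEq h2 hUc (z₀ := 2) (by simp [U]) ?_ hs
  have : ∀ᶠ s : ℂ in 𝓝 2, 1 < s.re :=
    (isOpen_lt continuous_const continuous_re).mem_nhds (by simp)
  filter_upwards [this] with s hs using LFunction_eq_mellin_aux hχ hs

lemma LFunction_bound {N : ℕ} [NeZero N] {χ : DirichletCharacter ℂ N} (hχ : χ ≠ 1) {l : ℝ}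
    (hl : 4 ≤ l) (hN : Real.log N ≤ l) {s : ℂ} (hs : 1 - 1 / l ≤ s.re) :
    ‖DirichletCharacter.LFunction χ s‖ ≤ 9 * ‖s‖ * l := by
  have hl0 : 0 < l := by linarith
  have h14 : 1 / l ≤ 1 / 4 := one_div_le_one_div_of_le (by norm_num) hl
  have hs0 : 0 < s.re := by linarith
  have hN1 : (1:ℝ) ≤ N := by exact_mod_cast NeZero.one_le
  rw [LFunction_eq_mellin hχ hs0, norm_mul]
  have hint : ‖mellin (cf χ) (-s)‖ ≤ ∫ t in Set.Ioi (1:ℝ), 9 * t ^ (- (1 / l) - 1) := by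
    unfold mellin
    rw [cf_int, integral_Ici_eq_integral_Ioi]
    refine norm_integral_le_of_norm_le ((integrableOn_Ioi_rpow_of_lt (by
      have : 0 < 1 / l := by positivity
      linarith) one_pos).const_mul 9) ?_
    refine (ae_restrict_iff' measurableSet_Ioi).mpr (Eventually.of_forall fun t ht => ?_)
    have ht1 : (1:ℝ) < t := ht
    have ht0 : (0:ℝ) < t := by linarith
    rw [norm_smul, norm_cpow_eq_rpow_re_of_pos ht0]
    have hb1 : ‖cf χ t‖ ≤ t := (cs_le_self χ _).trans (Nat.floor_le ht0.le)
    have hb2 : ‖cf χ t‖ ≤ N := cs_le_mod hχ _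
    have hlt : 0 ≤ 1 - 2 / l := by
      have : 2 / l = 2 * (1 / l) := by ring
      linarith
    have hb : ‖cf χ t‖ ≤ 9 * t ^ (1 - 2 / l) := by
      have : ‖cf χ t‖ = ‖cf χ t‖ ^ (1 - 2 / l) * ‖cf χ t‖ ^ (2 / l) := by
        rcases eq_or_lt_of_le (norm_nonneg (cf χ t)) with h | h
        · rw [← h, Real.zero_rpow (x := 2 / l) (by positivity)]; simp
        · rw [← Real.rpow_add h]; simp
      rw [this, mul_comm (9:ℝ)]
      have h9 : ‖cf χ t‖ ^ (2 / l) ≤ 9 := by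
        calc ‖cf χ t‖ ^ (2 / l) ≤ (N:ℝ) ^ (2 / l) :=
              Real.rpow_le_rpow (norm_nonneg _) hb2 (by positivity)
          _ = Real.exp (Real.log N * (2 / l)) := Real.rpow_def_of_pos (by linarith) _
          _ ≤ Real.exp 2 := by
              apply Real.exp_le_exp.mpr
              calc Real.log N * (2 / l) ≤ l * (2 / l) := by gcongr
                _ = 2 := by field_simp
          _ ≤ 9 := by
              have : Real.exp 2 = Real.exp 1 * Real.exp 1 := by rw [← Real.exp_add]; norm_num
              rw [this]
              have := Real.exp_one_lt_d9
              nlinarith [Real.exp_pos 1]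
      have hh : ‖cf χ t‖ ^ (1 - 2 / l) ≤ t ^ (1 - 2 / l) :=
        Real.rpow_le_rpow (norm_nonneg _) hb1 hlt
      exact mul_le_mul hh h9 (by positivity) (by positivity)
    calc t ^ (-s - 1).re * ‖cf χ t‖ ≤ t ^ (-(1 - 1 / l) - 1) * (9 * t ^ (1 - 2 / l)) := by
          gcongr
          · exact ht1.le
          · simp only [sub_re, neg_re, one_re]; linarith
      _ = 9 * (t ^ (-(1 - 1 / l) - 1) * t ^ (1 - 2 / l)) := by ring
      _ = _ := by
          rw [← Real.rpow_add ht0]; congr 2; ring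
  rw [integral_const_mul, integral_Ioi_rpow_of_lt (by
      have : 0 < 1 / l := by positivity
      linarith) one_pos] at hint
  have : (9:ℝ) * (-1 ^ (-(1 / l) - 1 + 1) / (-(1 / l) - 1 + 1)) = 9 * l := by
    simp
  rw [this] at hint
  calc ‖s‖ * ‖mellin (cf χ) (-s)‖ ≤ ‖s‖ * (9 * l) := by gcongr
    _ = _ := by ring
end CInf

namespace CInf
open Complex Filter Topology MeasureTheory Asymptotics DirichletCharacter

lemma LF_bd {N : ℕ} [NeZero N] {χ : DirichletCharacter ℂ N} (hχ : χ ≠ 1) {l : ℝ}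
    (hl : 4 ≤ l) (hN : Real.log N ≤ l) {s : ℂ} (hs : ‖s - 1‖ ≤ 1 / l) :
    ‖LFunction χ s‖ ≤ 12 * l := by
  have h14 : 1 / l ≤ 1 / 4 := one_div_le_one_div_of_le (by norm_num) hl
  have h1 : ‖s‖ ≤ 1 + 1 / 4 := by
    calc ‖s‖ = ‖1 + (s - 1)‖ := by congr 1; ring
      _ ≤ ‖(1:ℂ)‖ + ‖s - 1‖ := norm_add_le _ _
      _ ≤ _ := by simp only [norm_one]; linarith
  have h2 : 1 - 1 / l ≤ s.re := by
    have := (abs_le.mp ((abs_re_le_norm (s - 1)).trans hs)).1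
    simp at this ⊢; linarith
  refine (LFunction_bound hχ hl hN h2).trans ?_
  nlinarith

lemma LF_deriv_bd {N : ℕ} [NeZero N] {χ : DirichletCharacter ℂ N} (hχ : χ ≠ 1) {l : ℝ}
    (hl : 4 ≤ l) (hN : Real.log N ≤ l) {s : ℂ} (hs : ‖s - 1‖ ≤ 1 / (2 * l)) :
    ‖deriv (LFunction χ) s‖ ≤ 24 * l ^ 2 := by
  have hl0 : 0 < l := by linarith
  have := norm_deriv_le_of_forall_mem_sphere_norm_le (c := s) (R := 1 / (2 * l)) (C := 12 * l)
    (f := LFunction χ) (by positivity) (differentiable_LFunction hχ).diffContOnCl ?_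
  · refine this.trans (le_of_eq ?_)
    field_simp; ring
  · intro z hz
    refine LF_bd hχ hl hN ?_
    have hz' : ‖z - s‖ = 1 / (2 * l) := by simpa [dist_eq_norm] using hz
    calc ‖z - 1‖ = ‖(z - s) + (s - 1)‖ := by congr 1; ring
      _ ≤ ‖z - s‖ + ‖s - 1‖ := norm_add_le _ _
      _ ≤ 1 / (2 * l) + 1 / (2 * l) := by linarith
      _ = 1 / l := by field_simp; norm_num

lemma LF_lip {N : ℕ} [NeZero N] {χ : DirichletCharacter ℂ N} (hχ : χ ≠ 1) {l : ℝ}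
    (hl : 4 ≤ l) (hN : Real.log N ≤ l) {s w : ℂ} (hs : ‖s - 1‖ ≤ 1 / (2 * l))
    (hw : ‖w - 1‖ ≤ 1 / (2 * l)) :
    ‖LFunction χ s - LFunction χ w‖ ≤ 24 * l ^ 2 * ‖s - w‖ := by
  refine Convex.norm_image_sub_le_of_norm_deriv_le (s := Metric.closedBall (1:ℂ) (1 / (2 * l)))
    (fun z _ => (differentiable_LFunction hχ) z) (fun z hz => LF_deriv_bd hχ hl hN ?_)
    (convex_closedBall _ _) ?_ ?_
  · simpa [dist_eq_norm] using hz
  · simpa [dist_eq_norm] using hw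
  · simpa [dist_eq_norm] using hs

lemma summable_pow {x : ℝ} (hx : 0 < x) : Summable (fun n : ℕ => ((n:ℝ) ^ (-(1 + x)))) :=
  Real.summable_nat_rpow.mpr (by linarith)

lemma tsum_pow_le {x : ℝ} (hx : 0 < x) (hx1 : x ≤ 1) :
    ∑' n : ℕ, ((n:ℝ) ^ (-(1 + x))) ≤ 2 / x := by
  have h := ZetaAsymptotics.zeta_limit_aux1 (s := 1 + x) (by linarith)
  have h2 : 0 ≤ ZetaAsymptotics.termTSum (1 + x) :=
    tsum_nonneg fun n => ZetaAsymptotics.term_nonneg _ _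
  have e : ∑' n : ℕ, ((n:ℝ) ^ (-(1 + x))) = ∑' n : ℕ, 1 / ((n:ℝ) + 1) ^ (1 + x) := by
    rw [(summable_pow hx).tsum_eq_zero_add]
    rw [Nat.cast_zero, Real.zero_rpow (by linarith), zero_add]
    refine tsum_congr fun n => ?_
    push_cast
    rw [Real.rpow_neg (by positivity), one_div]
  rw [e]
  have : 1 / (1 + x - 1) = 1 / x := by ring
  rw [this] at h
  have h3 : 1 ≤ 1 / x := by rw [le_div_iff₀ hx]; linarith
  have h4 : 0 ≤ (1 + x) * ZetaAsymptotics.termTSum (1 + x) := by positivity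
  have : 2 / x = 1 / x + 1 / x := by ring
  linarith

lemma norm_LSeries_le {f : ℕ → ℂ} (hf : ∀ n, ‖f n‖ ≤ 1) {x : ℝ} (hx : 0 < x) (hx1 : x ≤ 1) :
    ‖LSeries f (1 + x)‖ ≤ 2 / x := by
  refine (tsum_of_norm_bounded (summable_pow hx).hasSum fun n => ?_).trans (tsum_pow_le hx hx1)
  rw [LSeries.norm_term_eq]
  split_ifs with h
  · positivity
  · rw [Real.rpow_neg (by positivity), ← one_div]
    simp only [add_re, one_re, ofReal_re]
    gcongr
    exact hf n

lemma triv_bd {N : ℕ} [NeZero N] {x : ℝ} (hx : 0 < x) (hx1 : x ≤ 1) :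
    ‖LFunctionTrivChar N (1 + x)‖ ≤ 2 / x := by
  rw [LFunctionTrivChar, LFunction_eq_LSeries _ (by simpa using hx)]
  exact norm_LSeries_le (fun n => DirichletCharacter.norm_le_one _ _) hx hx1

lemma zeta_bd {x : ℝ} (hx : 0 < x) (hx1 : x ≤ 1) :
    ‖riemannZeta (1 + x)‖ ≤ 2 / x := by
  rw [← LSeries_one_eq_riemannZeta (by simpa using hx)]
  exact norm_LSeries_le (fun n => by simp) hx hx1

/-- the small parameter -/
noncomputable def xx (l : ℝ) : ℝ := 1 / (216 ^ 5 * l ^ 9)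

lemma xx_pos {l : ℝ} (hl : 4 ≤ l) : 0 < xx l := by unfold xx; positivity

lemma xx_eq {l : ℝ} (hl : 4 ≤ l) : xx l * (216 ^ 5 * l ^ 9) = 1 := by
  unfold xx
  have : 0 < l := by linarith
  field_simp

lemma xx_le {l : ℝ} (hl : 4 ≤ l) : 4 * xx l ≤ 1 / (2 * l) := by
  have h0 : 0 < l := by linarith
  have h1 : 1 ≤ l ^ 8 := one_le_pow₀ (by linarith)
  rw [le_div_iff₀ (by positivity)]
  have := xx_eq hl
  have h2 := xx_pos hl
  have h3 : xx l * l * 1 ≤ xx l * l * l ^ 8 := by gcongr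
  nlinarith

lemma lower_complex {N : ℕ} [NeZero N] {χ : DirichletCharacter ℂ N} (hχ : χ ≠ 1) (hχ2 : χ ^ 2 ≠ 1)
    {l : ℝ} (hl : 4 ≤ l) (hN : Real.log N ≤ l) {s : ℂ} (hs : ‖s - 1‖ ≤ xx l / 2) :
    27 * l ^ 2 * xx l ≤ ‖LFunction χ s‖ := by
  set x := xx l with hx
  have hx0 : 0 < x := xx_pos hl
  have hl0 : 0 < l := by linarith
  have hxl : 4 * x ≤ 1 / (2 * l) := xx_le hl
  have hx1 : x ≤ 1 := by
    have : 1 / (2 * l) ≤ 1 := by rw [div_le_one (by positivity)]; linarith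
    linarith
  have h2l : 1 / (2 * l) ≤ 1 / l := by gcongr; linarith
  have hre : |s.re - 1| ≤ x / 2 := by simpa using (abs_re_le_norm (s - 1)).trans hs
  have him : |s.im| ≤ x / 2 := by simpa using (abs_im_le_norm (s - 1)).trans hs
  rw [abs_le] at hre him
  have h341 := norm_LFunction_product_ge_one χ hx0 s.im
  rw [norm_mul, norm_mul, norm_pow, norm_pow] at h341
  have hA := triv_bd (N := N) hx0 hx1
  have hC : ‖LFunction (χ ^ 2) (1 + x + 2 * I * s.im)‖ ≤ 12 * l := by
    refine LF_bd hχ2 hl hN ?_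
    have : ‖(1 + x + 2 * I * s.im - 1 : ℂ)‖ ≤ |x| + |2 * s.im| := by
      convert norm_le_abs_re_add_abs_im _ using 3 <;> simp
    refine this.trans ?_
    rw [abs_of_pos hx0]
    have : |2 * s.im| ≤ x := by rw [abs_le]; constructor <;> linarith
    linarith
  set B := ‖LFunction χ (1 + x + I * s.im)‖ with hB
  have hB0 : 0 ≤ B := norm_nonneg _
  have hlip : ‖LFunction χ (1 + x + I * s.im) - LFunction χ s‖ ≤ 24 * l ^ 2 * (3 / 2 * x) := by
    refine (LF_lip hχ hl hN ?_ (by linarith)).trans ?_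
    · have : ‖(1 + x + I * s.im - 1 : ℂ)‖ ≤ |x| + |s.im| := by
        convert norm_le_abs_re_add_abs_im _ using 3 <;> simp
      refine this.trans ?_
      rw [abs_of_pos hx0]
      have : |s.im| ≤ x := by rw [abs_le]; constructor <;> linarith
      linarith
    · gcongr
      have : ‖(1 + x + I * s.im - s : ℂ)‖ ≤ |1 + x - s.re| + |0| := by
        convert norm_le_abs_re_add_abs_im _ using 3 <;> simp
      refine this.trans ?_
      rw [abs_zero, add_zero, abs_le]; constructor <;> linarith
  by_contra hcon
  push Not at hcon
  have hBlt : B < 63 * l ^ 2 * x := by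
    have : B ≤ ‖LFunction χ (1 + x + I * s.im) - LFunction χ s‖ + ‖LFunction χ s‖ := by
      rw [hB]
      calc _ = ‖(LFunction χ (1 + x + I * s.im) - LFunction χ s) + LFunction χ s‖ := by
            congr 1; ring
        _ ≤ _ := norm_add_le _ _
    linarith
  have h1 : (1:ℝ) ≤ (2 / x) ^ 3 * (63 * l ^ 2 * x) ^ 4 * (12 * l) := by
    refine h341.trans ?_
    gcongr
  have h2 : (2 / x) ^ 3 * (63 * l ^ 2 * x) ^ 4 * (12 * l) = (8 * 63 ^ 4 * 12) * (x * l ^ 9) := by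
    field_simp; norm_num
  rw [h2] at h1
  have := xx_eq hl
  rw [← hx] at this
  nlinarith

/-- The modulus is bad for parameter `l`. -/
def Bad (l : ℝ) (N : ℕ) : Prop := ∃ _ : NeZero N, ∃ χ : DirichletCharacter ℂ N, χ ≠ 1 ∧ χ ^ 2 = 1 ∧
  ‖LFunction χ 1‖ < 54 * l ^ 2 * xx l

lemma lower_good {N : ℕ} [NeZero N] {l : ℝ} (hl : 4 ≤ l) (hN : Real.log N ≤ l) (hb : ¬ Bad l N)
    {χ : DirichletCharacter ℂ N} (hχ : χ ≠ 1) {s : ℂ} (hs : ‖s - 1‖ ≤ xx l / 2) :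
    27 * l ^ 2 * xx l ≤ ‖LFunction χ s‖ := by
  by_cases h2 : χ ^ 2 = 1
  · have h1 : 54 * l ^ 2 * xx l ≤ ‖LFunction χ 1‖ := by
      by_contra hc
      exact hb ⟨inferInstance, χ, hχ, h2, not_le.mp hc⟩
    have hx0 := xx_pos hl
    have hxl := xx_le hl
    have := LF_lip hχ hl hN (s := 1) (w := s) (by simp; linarith) (by linarith)
    rw [norm_sub_rev 1 s] at this
    have h3 : ‖LFunction χ 1‖ ≤ ‖LFunction χ 1 - LFunction χ s‖ + ‖LFunction χ s‖ := by
      calc _ = ‖(LFunction χ 1 - LFunction χ s) + LFunction χ s‖ := by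
            congr 1; ring
        _ ≤ _ := norm_add_le _ _
    have h4 : 24 * l ^ 2 * ‖s - 1‖ ≤ 24 * l ^ 2 * (xx l / 2) := by gcongr
    have h5 : 0 < l ^ 2 * xx l := by positivity
    nlinarith
  · exact lower_complex hχ h2 hl hN hs

lemma val_real {N : ℕ} {χ : DirichletCharacter ℂ N} (h2 : χ ^ 2 = 1) (n : ℕ) :
    χ n = 0 ∨ χ n = 1 ∨ χ n = -1 := by
  by_cases hu : IsUnit (n : ZMod N)
  · right
    have : (χ ^ 2) n = 1 := by rw [h2, MulChar.one_apply hu]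
    rw [MulChar.pow_apply' _ two_ne_zero] at this
    have h := mul_self_eq_one_iff.mp ((sq (χ (n : ZMod N))).symm.trans this)
    exact h
  · left; exact χ.map_nonunit hu

lemma prod_char {m₁ m₂ : ℕ} [NeZero m₁] [NeZero m₂] (hc : Nat.Coprime m₁ m₂)
    {χ₁ : DirichletCharacter ℂ m₁} {χ₂ : DirichletCharacter ℂ m₂} (h1 : χ₁ ≠ 1) :
    ∃ χ : DirichletCharacter ℂ (m₁ * m₂), χ ≠ 1 ∧ ∀ n : ℕ, χ n = χ₁ n * χ₂ n := by
  let χ : DirichletCharacter ℂ (m₁ * m₂) :=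
    changeLevel (Nat.dvd_mul_right m₁ m₂) χ₁ * changeLevel (Nat.dvd_mul_left m₂ m₁) χ₂
  have hval : ∀ n : ℕ, χ n = χ₁ n * χ₂ n := by
    intro n
    by_cases hn : Nat.Coprime n (m₁ * m₂)
    · simp only [χ, MulChar.mul_apply]
      have hu : IsUnit (n : ZMod (m₁ * m₂)) := (ZMod.isUnit_iff_coprime _ _).mpr hn
      congr 1
      · have := changeLevel_eq_cast_of_dvd χ₁ (Nat.dvd_mul_right m₁ m₂) hu.unit
        simpa using this
      · have := changeLevel_eq_cast_of_dvd χ₂ (Nat.dvd_mul_left m₂ m₁) hu.unit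
        simpa using this
    · rw [χ.map_nonunit (by rwa [ZMod.isUnit_iff_coprime])]
      rw [Nat.coprime_mul_iff_right] at hn
      by_cases h : Nat.Coprime n m₁
      · rw [χ₂.map_nonunit (by rw [ZMod.isUnit_iff_coprime]; tauto), mul_zero]
      · rw [χ₁.map_nonunit (by rwa [ZMod.isUnit_iff_coprime]), zero_mul]
  refine ⟨χ, ?_, hval⟩
  intro h
  apply h1
  ext a
  obtain ⟨n, hn1, hn2⟩ := Nat.chineseRemainder hc (a : ZMod m₁).val 1
  have e1 : (n : ZMod m₁) = a := by
    rw [(ZMod.natCast_eq_natCast_iff _ _ _).mpr hn1]; simp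
  have e2 : (n : ZMod m₂) = 1 := by
    rw [(ZMod.natCast_eq_natCast_iff _ _ _).mpr hn2]; simp
  have hu : IsUnit (n : ZMod (m₁ * m₂)) := by
    rw [ZMod.isUnit_iff_coprime, Nat.coprime_mul_iff_right, ← ZMod.isUnit_iff_coprime,
      ← ZMod.isUnit_iff_coprime, e1, e2]
    exact ⟨a.isUnit, isUnit_one⟩
  have := hval n
  rw [h, MulChar.one_apply hu, e1, e2, map_one, mul_one] at this
  rw [← this]; simp

lemma factor_ge {X : ℝ} (h0 : 0 < X) (h1 : X < 1) {a b : ℂ} (ha : a = 0 ∨ a = 1 ∨ a = -1)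
    (hb : b = 0 ∨ b = 1 ∨ b = -1) :
    1 ≤ ‖(1 - (X:ℂ))⁻¹ * (1 - a * X)⁻¹ * (1 - b * X)⁻¹ * (1 - a * b * X)⁻¹‖ := by
  have key : ∀ r : ℝ, 0 < r → r ≤ 1 → ∀ z : ℂ, z = (r : ℂ) → 1 ≤ ‖z⁻¹‖ := by
    rintro r hr hr1 z rfl
    rw [norm_inv, norm_real, Real.norm_of_nonneg hr.le]
    exact (one_le_inv₀ hr).mpr hr1
  rw [← mul_inv, ← mul_inv, ← mul_inv]
  have hX2 : X ^ 2 < 1 := by nlinarith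
  have hX3 : 0 < 1 - X ^ 2 := by linarith
  have hX4 : 0 < 1 - X := by linarith
  have e4 : (1 - X) * (1 - X) ≤ 1 := by nlinarith
  have e5 : (1 - X^2) * (1 - X^2) ≤ 1 := by nlinarith [sq_nonneg X]
  rcases ha with rfl | rfl | rfl <;> rcases hb with rfl | rfl | rfl
  · exact key (1 - X) hX4 (by linarith) _ (by push_cast; ring)
  · exact key ((1 - X) * (1 - X)) (by positivity) e4 _ (by push_cast; ring)
  · exact key (1 - X ^ 2) hX3 (by nlinarith) _ (by push_cast; ring)
  · exact key ((1 - X) * (1 - X)) (by positivity) e4 _ (by push_cast; ring)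
  · exact key (((1 - X) * (1 - X)) * ((1 - X) * (1 - X))) (by positivity) (mul_le_one₀ e4 (by positivity) e4) _ (by push_cast; ring)
  · exact key ((1 - X ^ 2) * (1 - X ^ 2)) (by positivity) e5 _ (by push_cast; ring)
  · exact key (1 - X ^ 2) hX3 (by nlinarith) _ (by push_cast; ring)
  · exact key ((1 - X ^ 2) * (1 - X ^ 2)) (by positivity) e5 _ (by push_cast; ring)
  · exact key ((1 - X ^ 2) * (1 - X ^ 2)) (by positivity) e5 _ (by push_cast; ring)

lemma four_prod {m₁ m₂ m₃ : ℕ} [NeZero m₁] [NeZero m₂] [NeZero m₃]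
    {χ₁ : DirichletCharacter ℂ m₁} {χ₂ : DirichletCharacter ℂ m₂} {χ₃ : DirichletCharacter ℂ m₃}
    (h1 : χ₁ ^ 2 = 1) (h2 : χ₂ ^ 2 = 1) (h3 : ∀ n : ℕ, χ₃ n = χ₁ n * χ₂ n) {x : ℝ} (hx : 0 < x) :
    1 ≤ ‖riemannZeta (1 + x) * LFunction χ₁ (1 + x) * LFunction χ₂ (1 + x) *
      LFunction χ₃ (1 + x)‖ := by
  have hs : 1 < (1 + x : ℂ).re := by simpa using hx
  rw [LFunction_eq_LSeries _ hs, LFunction_eq_LSeries _ hs, LFunction_eq_LSeries _ hs]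
  have := (((riemannZeta_eulerProduct_hasProd hs).mul (LSeries_eulerProduct_hasProd χ₁ hs)).mul
    (LSeries_eulerProduct_hasProd χ₂ hs)).mul (LSeries_eulerProduct_hasProd χ₃ hs)
  refine ge_of_tendsto (this.norm) (Eventually.of_forall fun S => ?_)
  refine Finset.one_le_prod fun p _ => ?_
  have hp : (0:ℝ) < (p : ℕ) := by exact_mod_cast p.2.pos
  have hX : (((p : ℕ) : ℂ) ^ (-(1 + x : ℂ))) = ((((p : ℕ) : ℝ) ^ (-(1 + x)) : ℝ) : ℂ) := by
    rw [ofReal_cpow hp.le]; push_cast; rfl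
  have h := factor_ge (X := ((p : ℕ) : ℝ) ^ (-(1 + x))) (by positivity)
    (Real.rpow_lt_one_of_one_lt_of_neg (by exact_mod_cast p.2.one_lt) (by linarith))
    (val_real h1 p) (val_real h2 p)
  rw [← hX, ← h3] at h
  exact h

lemma bad_coprime {l : ℝ} (hl : 4 ≤ l) {m₁ m₂ : ℕ} (hc : Nat.Coprime m₁ m₂)
    (hm1 : Real.log m₁ ≤ l) (hm2 : Real.log m₂ ≤ l) (hb1 : Bad l m₁) (hb2 : Bad l m₂) : False := by
  obtain ⟨_, χ₁, h11, h12, h13⟩ := hb1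
  obtain ⟨_, χ₂, h21, h22, h23⟩ := hb2
  obtain ⟨χ₃, h31, h32⟩ := prod_char hc (χ₂ := χ₂) h11
  set x := xx l with hx
  have hx0 : 0 < x := xx_pos hl
  have hl0 : 0 < l := by linarith
  have hxl : 4 * x ≤ 1 / (2 * l) := xx_le hl
  have hx1 : x ≤ 1 := by
    have : 1 / (2 * l) ≤ 1 := by rw [div_le_one (by positivity)]; linarith
    linarith
  have hnx : ‖(1 + x - 1 : ℂ)‖ = x := by simp [abs_of_pos hx0]
  have hnx' : ‖(1 + x : ℂ) - 1‖ ≤ 1 / (2 * l) := by rw [hnx]; linarith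
  have hA := zeta_bd hx0 hx1
  have hB : ∀ {m : ℕ} [NeZero m] (χ : DirichletCharacter ℂ m), χ ≠ 1 → Real.log m ≤ l →
      ‖LFunction χ 1‖ < 54 * l ^ 2 * x → ‖LFunction χ (1 + x)‖ ≤ 78 * l ^ 2 * x := by
    intro m _ χ hχ hm h
    have := LF_lip hχ hl hm (s := 1 + x) (w := 1) hnx' (by simp; positivity)
    rw [hnx] at this
    have h3 : ‖LFunction χ (1 + x)‖ ≤ ‖LFunction χ (1 + x) - LFunction χ 1‖ + ‖LFunction χ 1‖ := by
      calc _ = ‖(LFunction χ (1 + x) - LFunction χ 1) + LFunction χ 1‖ := by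
            congr 1; ring
        _ ≤ _ := norm_add_le _ _
    linarith
  have hB1 := hB χ₁ h11 hm1 h13
  have hB2 := hB χ₂ h21 hm2 h23
  have hC : ‖LFunction χ₃ (1 + x)‖ ≤ 12 * (2 * l) := by
    refine LF_bd h31 (by linarith) ?_ hnx'
    push_cast
    rw [Real.log_mul (by simpa using NeZero.ne m₁) (by simpa using NeZero.ne m₂)]
    linarith
  have h4 := four_prod h12 h22 h32 hx0
  rw [norm_mul, norm_mul, norm_mul] at h4
  have h5 : (1:ℝ) ≤ (2 / x) * (78 * l ^ 2 * x) * (78 * l ^ 2 * x) * (12 * (2 * l)) := by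
    refine h4.trans ?_
    gcongr
  have h6 : (2 / x) * (78 * l ^ 2 * x) * (78 * l ^ 2 * x) * (12 * (2 * l)) = 292032 * (x * l ^ 5) := by
    field_simp; norm_num
  rw [h6] at h5
  have := xx_eq hl
  rw [← hx] at this
  have h7 : x * l ^ 5 ≤ x * l ^ 9 := by
    gcongr
    · linarith
    · norm_num
  nlinarith
end CInf

namespace CInf
open Complex Filter Topology MeasureTheory Asymptotics DirichletCharacter

lemma prime_term {p : ℕ} (hp : p.Prime) {s : ℂ} (hs : 1/2 ≤ s.re) :
    (1 - (p:ℂ)^(-s)) ≠ 0 ∧ DifferentiableAt ℂ (fun s : ℂ => 1 - (p:ℂ)^(-s)) s ∧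
    ‖logDeriv (fun s : ℂ => 1 - (p:ℂ)^(-s)) s‖ ≤ 3 * Real.log p := by
  have hp0 : (p:ℂ) ≠ 0 := by exact_mod_cast hp.ne_zero
  have hn : ‖(p:ℂ)^(-s)‖ ≤ 3/4 := by
    rw [Complex.norm_natCast_cpow_of_pos hp.pos]
    have h2 : (2:ℝ) ≤ p := by exact_mod_cast hp.two_le
    calc (p:ℝ)^((-s).re) ≤ (p:ℝ)^(-(1/2):ℝ) := by
          apply Real.rpow_le_rpow_of_exponent_le (by linarith); simp; linarith
      _ ≤ (2:ℝ)^(-(1/2):ℝ) := Real.rpow_le_rpow_of_nonpos (by norm_num) h2 (by norm_num)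
      _ ≤ 3/4 := by
          rw [Real.rpow_neg (by norm_num), ← Real.sqrt_eq_rpow]
          rw [inv_le_comm₀ (by positivity) (by norm_num)]
          apply Real.le_sqrt_of_sq_le; norm_num
  have hl : 1/4 ≤ ‖1 - (p:ℂ)^(-s)‖ := by
    have := norm_sub_norm_le (1:ℂ) ((p:ℂ)^(-s))
    rw [norm_one] at this; linarith
  have hd : HasDerivAt (fun s : ℂ => 1 - (p:ℂ)^(-s)) (-((p:ℂ)^(-s) * Complex.log p * (-1))) s := by
    exact ((hasDerivAt_neg s).const_cpow (Or.inl hp0)).const_sub 1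
  refine ⟨by intro h; rw [h] at hl; norm_num at hl, hd.differentiableAt, ?_⟩
  rw [logDeriv_apply, hd.deriv, norm_div, div_le_iff₀ (by linarith)]
  have : ‖Complex.log p‖ = Real.log p := by
    rw [← Complex.natCast_log, Complex.norm_of_nonneg (Real.log_natCast_nonneg p)]
  rw [norm_neg, norm_mul, norm_mul, this, norm_neg, norm_one, mul_one]
  have h0 : 0 ≤ Real.log p := Real.log_natCast_nonneg p
  nlinarith [mul_le_mul_of_nonneg_right hn h0, mul_le_mul_of_nonneg_right hl h0]

lemma triv1_eq (m : ℕ) [NeZero m] (s : ℂ) :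
    LFunctionTrivChar₁ m s = (∏ p ∈ m.primeFactors, (1 - (p : ℂ) ^ (-s))) * LFunctionTrivChar₁ 1 s := by
  rcases eq_or_ne s 1 with rfl | hs
  · simp [cpow_neg_one]
  · rw [LFunctionTrivChar₁, LFunctionTrivChar₁, Function.update_of_ne hs, Function.update_of_ne hs,
      LFunctionTrivChar_eq_mul_riemannZeta hs, LFunctionTrivChar_eq_mul_riemannZeta hs]
    simp; ring

lemma H_bound : ∃ r0 > 0, r0 ≤ 1/2 ∧ ∃ C0 : ℝ, ∀ (m : ℕ) [NeZero m] (s : ℂ), ‖s - 1‖ < r0 →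
    LFunctionTrivChar₁ m s ≠ 0 ∧ ‖logDeriv (LFunctionTrivChar₁ m) s‖ ≤ 3 * Real.log m + C0 := by
  have h := differentiable_LFunctionTrivChar₁ 1
  have h1 := LFunctionTrivChar₁_apply_one_ne_zero 1
  have hc : ContinuousAt (logDeriv (LFunctionTrivChar₁ 1)) 1 :=
    ((h.contDiff.continuous_deriv le_rfl).continuousAt.div h.continuous.continuousAt h1)
  have e1 : ∀ᶠ s in 𝓝 (1:ℂ), LFunctionTrivChar₁ 1 s ≠ 0 := h.continuous.continuousAt.eventually_ne h1
  have e2 : ∀ᶠ s in 𝓝 (1:ℂ), ‖logDeriv (LFunctionTrivChar₁ 1) s‖ < ‖logDeriv (LFunctionTrivChar₁ 1) 1‖ + 1 :=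
    hc.norm.eventually_lt_const (by linarith)
  obtain ⟨r, hr, hr'⟩ := Metric.eventually_nhds_iff.mp (e1.and e2)
  refine ⟨min r (1/2), by positivity, min_le_right _ _, ‖logDeriv (LFunctionTrivChar₁ 1) 1‖ + 1, ?_⟩
  intro m _ s hs
  have hs1 : ‖s - 1‖ < r := lt_of_lt_of_le hs (min_le_left _ _)
  have hs2 : ‖s - 1‖ < 1/2 := lt_of_lt_of_le hs (min_le_right _ _)
  obtain ⟨ha, hb⟩ := hr' (y := s) (by rwa [dist_eq_norm])
  have hre : 1/2 ≤ s.re := by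
    have := (abs_le.mp ((Complex.abs_re_le_norm (s-1)).trans hs2.le)).1
    simp at this; linarith
  have hp : ∏ p ∈ m.primeFactors, (1 - (p : ℂ) ^ (-s)) ≠ 0 :=
    Finset.prod_ne_zero_iff.mpr fun p hp => (prime_term (Nat.prime_of_mem_primeFactors hp) hre).1
  refine ⟨by rw [triv1_eq]; exact mul_ne_zero hp ha, ?_⟩
  have e : LFunctionTrivChar₁ m = fun s => (∏ p ∈ m.primeFactors, (1 - (p : ℂ) ^ (-s))) * LFunctionTrivChar₁ 1 s :=
    funext (triv1_eq m)
  rw [e, logDeriv_mul s hp ha _ h.differentiableAt, logDeriv_prod]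
  · have hsum : ∑ p ∈ m.primeFactors, 3 * Real.log p ≤ 3 * Real.log m := by
      rw [← Finset.mul_sum, ← Real.log_prod]
      · have : ((∏ p ∈ m.primeFactors, (p:ℝ))) ≤ m := by
          have := Nat.le_of_dvd (Nat.pos_of_ne_zero (NeZero.ne m)) (Nat.prod_primeFactors_dvd m)
          rw [← Nat.cast_prod]; exact_mod_cast this
        have h0 : 0 < ((∏ p ∈ m.primeFactors, (p:ℝ))) :=
          Finset.prod_pos fun p hp => by exact_mod_cast (Nat.prime_of_mem_primeFactors hp).pos
        linarith [Real.log_le_log h0 this]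
      · intro p hp; exact_mod_cast (Nat.prime_of_mem_primeFactors hp).ne_zero
    calc _ ≤ _ := norm_add_le _ _
      _ ≤ _ := add_le_add (((norm_sum_le _ _).trans (Finset.sum_le_sum fun p hp => (prime_term (Nat.prime_of_mem_primeFactors hp) hre).2.2)).trans hsum) hb.le
  · exact fun p hp => (prime_term (Nat.prime_of_mem_primeFactors hp) hre).1
  · exact fun p hp => (prime_term (Nat.prime_of_mem_primeFactors hp) hre).2.1
  · exact DifferentiableAt.fun_finsetProd fun p hp => (prime_term (Nat.prime_of_mem_primeFactors hp) hre).2.1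

open ArithmeticFunction vonMangoldt in
/-- The error term. -/
noncomputable def EE (m : ℕ) [NeZero m] (s : ℂ) : ℂ :=
  -(∑ χ ∈ (Finset.univ.erase (1 : DirichletCharacter ℂ m)), logDeriv (LFunction χ) s)
    - logDeriv (LFunctionTrivChar₁ m) s

open ArithmeticFunction vonMangoldt in
lemma EE_eq (m : ℕ) [NeZero m] {s : ℂ} (hs : 1 < s.re) :
    (m.totient : ℂ) * LSeries (fun n => ((residueClass (1 : ZMod m) n : ℝ) : ℂ)) s
      = (s - 1)⁻¹ + EE m s := by
  have hs1 : s ≠ 1 := by rintro rfl; simp at hs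
  have ht : (m.totient : ℂ) ≠ 0 := by
    exact_mod_cast (Nat.totient_pos.mpr (Nat.pos_of_ne_zero (NeZero.ne m))).ne'
  have hne : LFunctionTrivChar m s ≠ 0 := LFunction_ne_zero_of_one_le_re 1 (.inr hs1) hs.le
  rw [LSeries_residueClass_eq isUnit_one hs, ← mul_assoc, mul_neg, mul_inv_cancel₀ ht, EE,
    ← Finset.add_sum_erase _ _ (Finset.mem_univ (1 : DirichletCharacter ℂ m)), logDeriv_apply (LFunctionTrivChar₁ m),
    deriv_LFunctionTrivChar₁_apply_of_ne_one _ hs1]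
  have hi : (1 : ZMod m)⁻¹ = 1 := ZMod.inv_one m
  have hi2 : ∀ χ : DirichletCharacter ℂ m, χ (1 : ZMod m)⁻¹ = 1 := fun χ => by rw [hi, map_one]
  simp only [logDeriv_apply, hi2, one_mul]
  rw [show LFunctionTrivChar₁ m s = (s-1) * LFunctionTrivChar m s from Function.update_of_ne hs1 _ _]
  have := sub_ne_zero_of_ne hs1
  field_simp
  ring

lemma EE_diff_bd : ∃ l0 : ℝ, 4 ≤ l0 ∧ ∀ l, l0 ≤ l → ∀ (m : ℕ) [NeZero m], Real.log m ≤ l → ¬ Bad l m →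
    ∀ s : ℂ, ‖s - 1‖ ≤ xx l / 2 → DifferentiableAt ℂ (EE m) s ∧ ‖EE m s‖ ≤ m.totient / xx l := by
  obtain ⟨r0, hr0, hr1, C0, hH⟩ := H_bound
  refine ⟨max 4 (max (1/r0) (3 + |C0|)), le_max_left _ _, ?_⟩
  intro l hl m _ hm hb s hs
  have hl4 : 4 ≤ l := le_trans (le_max_left _ _) hl
  have hl1 : 1/r0 ≤ l := le_trans ((le_max_left _ _).trans (le_max_right _ _)) hl
  have hl2 : 3 + |C0| ≤ l := le_trans ((le_max_right _ _).trans (le_max_right _ _)) hl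
  have hx := xx_pos hl4
  have hxe := xx_eq hl4
  have hxl := xx_le hl4
  have hl9 : l^2 ≤ l^9 := pow_le_pow_right₀ (by linarith) (by norm_num)
  have hx2 : l^2 ≤ 1 / xx l := by
    rw [le_div_iff₀ hx]; nlinarith
  have hsr : ‖s - 1‖ < r0 := by
    have : 1 / l ≤ r0 := by
      rw [div_le_iff₀ (by linarith)]; rw [div_le_iff₀ hr0] at hl1; linarith
    have h3 : 1 / (2*l) ≤ 1 / l := one_div_le_one_div_of_le (by linarith) (by linarith)
    linarith
  obtain ⟨hn, hb1⟩ := hH m s hsr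
  have hlow : ∀ χ : DirichletCharacter ℂ m, χ ≠ 1 → 27*l^2*xx l ≤ ‖LFunction χ s‖ :=
    fun χ hχ => lower_good hl4 hm hb hχ hs
  have hnz : ∀ χ : DirichletCharacter ℂ m, χ ≠ 1 → LFunction χ s ≠ 0 := by
    intro χ hχ h0
    have := hlow χ hχ
    rw [h0, norm_zero] at this
    have : 0 < 27*l^2*xx l := by positivity
    linarith
  constructor
  · unfold EE
    refine DifferentiableAt.sub (DifferentiableAt.neg (DifferentiableAt.fun_sum fun χ hχ => ?_)) ?_
    · have hχ1 := (Finset.mem_erase.mp hχ).1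
      have hd := differentiable_LFunction hχ1
      exact (hd.contDiff.differentiable_deriv_two s).div (hd s) (hnz χ hχ1)
    · have hd := differentiable_LFunctionTrivChar₁ m
      exact (hd.contDiff.differentiable_deriv_two s).div (hd s) hn
  · have hcard : (Finset.univ.erase (1 : DirichletCharacter ℂ m)).card + 1 = m.totient := by
      rw [Finset.card_erase_add_one (Finset.mem_univ _), Finset.card_univ, ← Nat.card_eq_fintype_card]
      exact DirichletCharacter.card_eq_totient_of_hasEnoughRootsOfUnity ℂ m
    have hterm : ∀ χ ∈ (Finset.univ.erase (1 : DirichletCharacter ℂ m)), ‖logDeriv (LFunction χ) s‖ ≤ 1 / xx l := by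
      intro χ hχ
      have hχ1 := (Finset.mem_erase.mp hχ).1
      rw [logDeriv_apply, norm_div, div_le_div_iff₀ (norm_pos_iff.mpr (hnz χ hχ1)) hx]
      have h1 := LF_deriv_bd hχ1 hl4 hm (s := s) (by linarith)
      have h2 := hlow χ hχ1
      have : ‖deriv (LFunction χ) s‖ * xx l ≤ 24*l^2*xx l := mul_le_mul_of_nonneg_right h1 hx.le
      have : 0 ≤ l^2 * xx l := by positivity
      linarith
    have hlog : 3 * Real.log m + C0 ≤ 1 / xx l := by
      have := le_abs_self C0
      nlinarith [abs_nonneg C0]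
    calc ‖EE m s‖ ≤ ‖∑ χ ∈ (Finset.univ.erase (1 : DirichletCharacter ℂ m)), logDeriv (LFunction χ) s‖ + ‖logDeriv (LFunctionTrivChar₁ m) s‖ := by
          unfold EE; refine (norm_sub_le _ _).trans ?_; rw [norm_neg]
      _ ≤ (Finset.univ.erase (1 : DirichletCharacter ℂ m)).card * (1 / xx l) + 1 / xx l := by
          refine add_le_add ((norm_sum_le _ _).trans ((Finset.sum_le_sum hterm).trans ?_)) (hb1.trans hlog)
          simp
      _ = m.totient / xx l := by rw [← hcard]; push_cast; ring

open ArithmeticFunction vonMangoldt in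
/-- summand -/
noncomputable def tf (m : ℕ) (δ : ℝ) (j : ℕ) (n : ℕ) : ℝ :=
  residueClass (1 : ZMod m) n * Real.log n ^ j * (n:ℝ)^(-(1+δ))

lemma logMul_iter (f : ℕ → ℂ) (j n : ℕ) : LSeries.logMul^[j] f n = ((Real.log n : ℝ):ℂ)^j * f n := by
  induction j generalizing f with
  | zero => simp
  | succ j ih => rw [Function.iterate_succ_apply, ih, LSeries.logMul, pow_succ, ← Complex.natCast_log]; ring

open ArithmeticFunction vonMangoldt in
lemma term_eq (m : ℕ) (δ : ℝ) (j n : ℕ) :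
    LSeries.term (LSeries.logMul^[j] (fun n => ((residueClass (1 : ZMod m) n : ℝ) : ℂ))) ((1 + δ : ℝ):ℂ) n
      = ((tf m δ j n : ℝ) : ℂ) := by
  rcases eq_or_ne n 0 with rfl | hn
  · simp [tf]
  · rw [LSeries.term_of_ne_zero hn, logMul_iter, tf, Real.rpow_neg (Nat.cast_nonneg n)]
    push_cast
    rw [Complex.ofReal_cpow (Nat.cast_nonneg n)]
    push_cast
    rw [div_eq_mul_inv]; ring

open ArithmeticFunction vonMangoldt in
lemma absc (m : ℕ) [NeZero m] : LSeries.abscissaOfAbsConv (fun n => ((residueClass (1 : ZMod m) n : ℝ) : ℂ)) ≤ 1 :=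
  abscissaOfAbsConv_residueClass_le_one 1

open ArithmeticFunction vonMangoldt in
lemma tf_summable (m : ℕ) [NeZero m] {δ : ℝ} (hδ : 0 < δ) (j : ℕ) : Summable (tf m δ j) := by
  have h : LSeriesSummable (LSeries.logMul^[j] (fun n => ((residueClass (1 : ZMod m) n : ℝ) : ℂ))) ((1 + δ : ℝ):ℂ) := by
    apply LSeriesSummable_of_abscissaOfAbsConv_lt_re
    rw [LSeries.absicssaOfAbsConv_logPowMul]
    refine lt_of_le_of_lt (absc m) ?_
    simp only [ofReal_re]
    exact_mod_cast (by linarith : (1:ℝ) < 1 + δ)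
  have h2 : Summable (fun n => ((tf m δ j n : ℝ) : ℂ)) := by
    refine h.congr fun n => (term_eq m δ j n)
  exact Complex.summable_ofReal.mp h2

open ArithmeticFunction vonMangoldt in
lemma tf_deriv (m : ℕ) [NeZero m] {δ : ℝ} (hδ : 0 < δ) (j : ℕ) :
    iteratedDeriv j (LSeries (fun n => ((residueClass (1 : ZMod m) n : ℝ) : ℂ))) ((1 + δ : ℝ):ℂ)
      = (-1)^j * ((∑' n, tf m δ j n : ℝ) : ℂ) := by
  rw [LSeries_iteratedDeriv]
  · congr 1
    rw [LSeries, Complex.ofReal_tsum]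
    exact tsum_congr fun n => term_eq m δ j n
  · refine lt_of_le_of_lt (absc m) ?_
    simp only [ofReal_re]
    exact_mod_cast (by linarith : (1:ℝ) < 1 + δ)

open ArithmeticFunction vonMangoldt in
lemma main_est : ∃ l0 : ℝ, 4 ≤ l0 ∧ ∀ l, l0 ≤ l → ∀ (m : ℕ) [NeZero m], Real.log m ≤ l → ¬ Bad l m →
    ∀ j : ℕ, 2*l ≤ j+1 → |m.totient * ∑' n, tf m (xx l/16) j n - j.factorial / (xx l/16)^(j+1)|
      ≤ 1/100 * (j.factorial / (xx l/16)^(j+1)) := by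
  obtain ⟨l0, hl0, hE⟩ := EE_diff_bd
  refine ⟨l0, hl0, ?_⟩
  intro l hl m _ hm hb j hj
  have hl4 : 4 ≤ l := hl0.trans hl
  have hx := xx_pos hl4
  set δ := xx l / 16 with hδ
  have hδ0 : 0 < δ := by positivity
  set c : ℂ := ((1+δ:ℝ):ℂ) with hc
  set f : ℕ → ℂ := (fun n => ((residueClass (1 : ZMod m) n : ℝ) : ℂ)) with hf
  have hev : (fun s => (m.totient : ℂ) * LSeries f s) =ᶠ[𝓝 c] fun s => (s-1)⁻¹ + EE m s := by
    have : ∀ᶠ s in 𝓝 c, 1 < s.re := by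
      refine Complex.continuous_re.continuousAt.eventually_const_lt ?_
      simp [hc, hδ0]
    filter_upwards [this] with s hs using EE_eq m hs
  have hball : ∀ s ∈ Metric.closedBall c (xx l/4), ‖s-1‖ ≤ xx l / 2 := by
    intro s hs
    rw [Metric.mem_closedBall, dist_eq_norm] at hs
    have : s - 1 = (s - c) + (δ:ℂ) := by rw [hc]; push_cast; ring
    rw [this]
    refine (norm_add_le _ _).trans ?_
    rw [Complex.norm_of_nonneg hδ0.le]; linarith
  have hdE : ∀ s ∈ Metric.closedBall c (xx l/4), DifferentiableAt ℂ (EE m) s :=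
    fun s hs => (hE l hl m hm hb s (hball s hs)).1
  have hCau : ‖iteratedDeriv j (EE m) c‖ ≤ j.factorial * (m.totient / xx l) / (xx l/4)^j := by
    apply Complex.norm_iteratedDeriv_le_of_forall_mem_sphere_norm_le j (by positivity)
    · apply DifferentiableOn.diffContOnCl
      rw [closure_ball _ (by positivity)]
      exact fun s hs => (hdE s hs).differentiableWithinAt
    · exact fun s hs => (hE l hl m hm hb s (hball s (Metric.sphere_subset_closedBall hs))).2
  have hkey := hev.iteratedDeriv_eq j
  have hcn : c - 1 = (δ:ℂ) := by rw [hc]; push_cast; ring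
  have hcd : ContDiffAt ℂ j (fun s : ℂ => (s-1)⁻¹) c := by
    refine ContDiffAt.inv (by fun_prop) ?_
    rw [hcn]; exact_mod_cast hδ0.ne'
  have hcE : ContDiffAt ℂ j (EE m) c := by
    have : DifferentiableOn ℂ (EE m) (Metric.ball c (xx l/4)) :=
      fun s hs => (hdE s (Metric.ball_subset_closedBall hs)).differentiableWithinAt
    exact (this.analyticAt (Metric.ball_mem_nhds c (by positivity))).contDiffAt
  rw [iteratedDeriv_const_mul_field, tf_deriv m hδ0, iteratedDeriv_fun_add hcd hcE] at hkey
  have hmain : iteratedDeriv j (fun s : ℂ => (s-1)⁻¹) c = (-1)^j * ((j.factorial / δ^(j+1) : ℝ):ℂ) := by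
    have := congrFun (iter_deriv_inv_linear_sub (𝕜 := ℂ) j 1 1) c
    simp only [one_mul, one_pow, mul_one] at this
    rw [iteratedDeriv_eq_iterate, this, hcn, mul_assoc, div_eq_mul_inv]
    push_cast
    congr 2
    rw [show (-1 - (j:ℤ)) = -((j+1:ℕ):ℤ) by push_cast; ring, zpow_neg, zpow_natCast]
  rw [hmain] at hkey
  have hd : (-1:ℂ)^j * ((m.totient * ∑' n, tf m δ j n - j.factorial / δ^(j+1) : ℝ):ℂ) = iteratedDeriv j (EE m) c := by
    push_cast at hkey ⊢
    linear_combination hkey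
  have hnorm : |m.totient * ∑' n, tf m δ j n - j.factorial / δ^(j+1)| = ‖iteratedDeriv j (EE m) c‖ := by
    rw [← hd, norm_mul, norm_pow, norm_neg, norm_one, one_pow, one_mul, Complex.norm_real, Real.norm_eq_abs]
  rw [hnorm]
  refine hCau.trans ?_
  have hphi : (m.totient : ℝ) ≤ Real.exp l := by
    have h1 : (m.totient:ℝ) ≤ m := by exact_mod_cast Nat.totient_le m
    have h0 : (0:ℝ) < m := by exact_mod_cast Nat.pos_of_ne_zero (NeZero.ne m)
    exact h1.trans ((Real.log_le_iff_le_exp h0).mp hm)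
  have hexp4 : Real.exp l * 25 ≤ 4^(j+1) := by
    have he : Real.exp 1 ≤ 4 := by linarith [Real.exp_one_lt_d9]
    have h25 : 25 ≤ Real.exp l := by
      calc (25:ℝ) ≤ 2.7^4 := by norm_num
        _ ≤ (Real.exp 1)^4 := by gcongr; linarith [Real.exp_one_gt_d9]
        _ = Real.exp 4 := by rw [← Real.exp_nat_mul]; norm_num
        _ ≤ _ := Real.exp_le_exp.mpr hl4
    calc Real.exp l * 25 ≤ Real.exp l * Real.exp l := by gcongr
      _ = Real.exp (2*l) := by rw [← Real.exp_add]; ring_nf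
      _ ≤ Real.exp ((j+1:ℕ) * 1) := by apply Real.exp_le_exp.mpr; push_cast; linarith
      _ = Real.exp 1 ^ (j+1) := Real.exp_nat_mul _ _
      _ ≤ 4^(j+1) := by gcongr
  have e1 : (xx l/4)^j = xx l^j / 4^j := div_pow _ _ _
  have e2 : δ^(j+1) = xx l^(j+1)/(4^(j+1)*4^(j+1)) := by rw [hδ, div_pow, ← mul_pow]; norm_num
  rw [e1, e2]
  have : (j.factorial:ℝ) * (m.totient / xx l) / (xx l^j/4^j) = j.factorial / xx l^(j+1) * 4^(j+1) * (m.totient / 4) := by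
    field_simp
    ring
  rw [this]
  have : 1/100 * ((j.factorial:ℝ) / (xx l^(j+1)/(4^(j+1)*4^(j+1)))) = j.factorial / xx l^(j+1) * 4^(j+1) * (4^(j+1)/100) := by
    field_simp
  rw [this]
  gcongr ?_ * ?_
  linarith
end CInf

namespace CInf
open Complex Filter Topology MeasureTheory Asymptotics DirichletCharacter
open ArithmeticFunction vonMangoldt

lemma log_pow_le {y η : ℝ} (hy : 1 ≤ y) (hη : 0 < η) (j : ℕ) :
    Real.log y ^ j ≤ j.factorial / η^j * y^η := by
  have h := Real.pow_div_factorial_le_exp (x := η * Real.log y) (mul_nonneg hη.le (Real.log_nonneg hy)) j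
  rw [div_le_iff₀ (by positivity), mul_pow] at h
  rw [div_mul_eq_mul_div, le_div_iff₀ (by positivity), Real.rpow_def_of_pos (by linarith)]
  rw [mul_comm (Real.log y) η]
  linarith

/-- nonprime part -/
noncomputable def h0 (n : ℕ) : ℝ := if n.Prime then 0 else vonMangoldt n * (n:ℝ)^(-(3/4):ℝ)

lemma h0_nonneg (n : ℕ) : 0 ≤ h0 n := by
  unfold h0; split_ifs
  · exact le_rfl
  · exact mul_nonneg vonMangoldt_nonneg (by positivity)

lemma pp_exists {n : ℕ} (hn : IsPrimePow n) (hp : ¬ n.Prime) : ∃ ab : ℕ × ℕ, ab.1^2*ab.2^3 = n := by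
  obtain ⟨p, k, hpp, hk, rfl⟩ := (isPrimePow_nat_iff n).mp hn
  rcases Nat.even_or_odd' k with ⟨i, rfl | rfl⟩
  · exact ⟨(p^i,1), by simp; ring⟩
  · rcases i with _ | i
    · simp at hp; exact absurd hpp hp
    · exact ⟨(p^i,p), by simp; ring⟩

lemma rp_e (a b : ℕ) : (((a^2*b^3 : ℕ)):ℝ)^(-(5/8):ℝ) = (a:ℝ)^(-(5/4):ℝ) * (b:ℝ)^(-(15/8):ℝ) := by
  push_cast
  rw [Real.mul_rpow (by positivity) (by positivity), ← Real.rpow_natCast (a:ℝ) 2, ← Real.rpow_natCast (b:ℝ) 3,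
    ← Real.rpow_mul (by positivity), ← Real.rpow_mul (by positivity)]
  congr 2 <;> norm_num

lemma h0_le {n : ℕ} (hn : 1 ≤ n) : h0 n ≤ 8 * (n:ℝ)^(-(5/8):ℝ) := by
  have hn1 : (1:ℝ) ≤ n := by exact_mod_cast hn
  unfold h0
  split_ifs
  · positivity
  have h2 : vonMangoldt (n:ℕ) ≤ 8 * (n:ℝ)^(1/8:ℝ) := by
    refine vonMangoldt_le_log.trans ?_
    have h := log_pow_le hn1 (η := 1/8) (by norm_num) 1
    rw [pow_one, pow_one, Nat.factorial_one, Nat.cast_one] at h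
    have e : (1:ℝ)/(1/8) = 8 := by norm_num
    rwa [e] at h
  calc _ ≤ 8 * (n:ℝ)^(1/8:ℝ) * (n:ℝ)^(-(3/4):ℝ) := by gcongr
    _ = 8 * (n:ℝ)^(-(5/8):ℝ) := by
      rw [mul_assoc, ← Real.rpow_add (by linarith)]
      congr 2; norm_num

lemma hs_aux : Summable (fun ab : ℕ × ℕ => (ab.1:ℝ)^(-(5/4):ℝ) * (ab.2:ℝ)^(-(15/8):ℝ)) := by
  have h1 : Summable (fun a : ℕ => (a:ℝ)^(-(5/4):ℝ)) := Real.summable_nat_rpow.mpr (by norm_num)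
  have h2 : Summable (fun a : ℕ => (a:ℝ)^(-(15/8):ℝ)) := Real.summable_nat_rpow.mpr (by norm_num)
  exact h1.mul_of_nonneg h2 (fun n => Real.rpow_nonneg (Nat.cast_nonneg n) _) (fun n => Real.rpow_nonneg (Nat.cast_nonneg n) _)

/-- nonprime prime powers -/
def AA : Set ℕ := {n | IsPrimePow n ∧ ¬ n.Prime}

lemma h1_aux : Summable (fun n : AA => h0 n) := by
  choose g hg using fun n : AA => pp_exists n.2.1 n.2.2
  have hinj : Function.Injective g := by
    intro a b hab
    apply Subtype.ext
    rw [← hg a, ← hg b, hab]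
  refine Summable.of_nonneg_of_le (fun n => h0_nonneg n) ?_ ((hs_aux.comp_injective hinj).mul_left 8)
  intro n
  have hn := hg n
  have hle := h0_le (n := (n:ℕ)) n.2.1.one_lt.le
  have e := rp_e (g n).1 (g n).2
  rw [hn] at e
  rw [e] at hle
  exact hle

lemma h0_summable : Summable h0 := by
  have h2 : Summable (AA.indicator h0) := (summable_subtype_iff_indicator (f := h0) (s := AA)).mp h1_aux
  refine h2.congr fun n => ?_
  by_cases hn : n ∈ AA
  · rw [Set.indicator_of_mem hn]
  · rw [Set.indicator_of_notMem hn]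
    unfold h0
    split_ifs with hp
    · rfl
    · have : ¬ IsPrimePow n := fun h => hn ⟨h, hp⟩
      rw [vonMangoldt_eq_zero_iff.mpr this, zero_mul]

/-- upper sum -/
lemma up_sum {l δ : ℝ} (hl : 4 ≤ l) (hδ : 0 < δ) (hδ1 : δ * (l+1) ≤ 1) {J : ℕ} (hJ : 2 ≤ J) :
    Summable (fun k : ℕ => Real.log (2 * Real.exp l * k) ^ J * (k:ℝ)^(-(1+δ))) ∧
    ∑' k : ℕ, Real.log (2 * Real.exp l * k) ^ J * (k:ℝ)^(-(1+δ)) ≤ 48 * J * J.factorial / δ^(J+1) := by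
  have hJ2 : (2:ℝ) ≤ J := by exact_mod_cast hJ
  have hle : ∀ k : ℕ, Real.log (2 * Real.exp l * k) ^ J * (k:ℝ)^(-(1+δ)) ≤
      24 * J.factorial / δ^J * (k:ℝ)^(-(1+δ/J)) := by
    intro k
    rcases Nat.eq_zero_or_pos k with rfl | hk
    · have h1 : -(1+δ) ≠ 0 := by linarith
      simp only [Nat.cast_zero]
      rw [Real.zero_rpow h1, mul_zero]; positivity
    have hk1 : (1:ℝ) ≤ k := by exact_mod_cast hk
    set η := δ * (1 - 1/J) with hη
    have hJi : 1/(J:ℝ) ≤ 1/2 := one_div_le_one_div_of_le (by norm_num) hJ2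
    have hη0 : 0 < η := by apply mul_pos hδ; linarith
    have hηδ : η ≤ δ := by rw [hη]; nlinarith [show 0 < 1/(J:ℝ) by positivity]
    have hexp : 1 ≤ Real.exp l := Real.one_le_exp (by linarith)
    have h2D : 1 ≤ 2 * Real.exp l := by linarith
    have h1 := log_pow_le (y := 2 * Real.exp l * k) (by nlinarith) hη0 J
    have h2 : 1/η^J ≤ 8/δ^J := by
      rw [hη, mul_pow]
      have h3 : 1/8 ≤ (1 - 1/(J:ℝ))^J := by
        have h4 : (1 - 1/(J:ℝ))⁻¹ ≤ Real.exp (1/(J-1)) := by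
          have := Real.add_one_le_exp (1/((J:ℝ)-1))
          have e : (1 - 1/(J:ℝ))⁻¹ = 1/((J:ℝ)-1) + 1 := by
            have : (J:ℝ) - 1 ≠ 0 := by linarith
            field_simp; ring
          rw [e]; exact this
        have h5 : ((1 - 1/(J:ℝ))⁻¹)^J ≤ 8 := by
          calc ((1 - 1/(J:ℝ))⁻¹)^J ≤ (Real.exp (1/(J-1)))^J := by
                gcongr; exact inv_nonneg.mpr (by linarith)
            _ = Real.exp (J * (1/(J-1))) := by rw [← Real.exp_nat_mul]
            _ ≤ Real.exp 2 := by
                apply Real.exp_le_exp.mpr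
                rw [mul_one_div, div_le_iff₀ (by linarith)]; linarith
            _ = Real.exp 1 ^ 2 := by rw [← Real.exp_nat_mul]; norm_num
            _ ≤ 2.7182818286^2 := by gcongr; exact Real.exp_one_lt_d9.le
            _ ≤ 8 := by norm_num
        rw [inv_pow] at h5
        rw [one_div]
        rw [inv_le_comm₀ (by norm_num)]
        · exact h5
        · apply pow_pos; linarith
      rw [div_le_div_iff₀ (by apply mul_pos; positivity; linarith) (by positivity)]
      nlinarith [show 0 < δ^J by positivity]
    have h3 : (2 * Real.exp l * k)^η ≤ 3 * (k:ℝ)^η := by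
      rw [Real.mul_rpow (by positivity) (by positivity)]
      gcongr
      calc (2 * Real.exp l)^η ≤ (2*Real.exp l)^δ := Real.rpow_le_rpow_of_exponent_le h2D hηδ
        _ ≤ (Real.exp (l+1))^δ := by
            apply Real.rpow_le_rpow (by positivity) _ hδ.le
            rw [Real.exp_add]; nlinarith [Real.exp_one_gt_d9]
        _ = Real.exp ((l+1)*δ) := by rw [← Real.exp_mul]
        _ ≤ Real.exp 1 := Real.exp_le_exp.mpr (by linarith)
        _ ≤ 3 := by linarith [Real.exp_one_lt_d9]
    calc Real.log (2 * Real.exp l * k) ^ J * (k:ℝ)^(-(1+δ))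
        ≤ (J.factorial * (1/ η^J) * (2 * Real.exp l * k)^η) * (k:ℝ)^(-(1+δ)) := by
          gcongr; refine h1.trans (le_of_eq ?_); ring
      _ ≤ (J.factorial * (8/δ^J) * (3 * (k:ℝ)^η)) * (k:ℝ)^(-(1+δ)) := by gcongr
      _ = 24 * J.factorial / δ^J * ((k:ℝ)^η * (k:ℝ)^(-(1+δ))) := by ring
      _ = _ := by
          rw [← Real.rpow_add (by linarith)]
          congr 2
          rw [hη]; ring
  have hδJ : 0 < δ/J := by positivity
  have hδJ1 : δ/J ≤ 1 := by
    rw [div_le_one (by linarith)]; nlinarith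
  have hs := (summable_pow hδJ).mul_left (24 * J.factorial / δ^J)
  have hnn : ∀ k : ℕ, 0 ≤ Real.log (2 * Real.exp l * k) ^ J * (k:ℝ)^(-(1+δ)) := by
    intro k
    rcases Nat.eq_zero_or_pos k with rfl | hk
    · have h1 : J ≠ 0 := by omega
      simp [h1]
    have hk1 : (1:ℝ) ≤ k := by exact_mod_cast hk
    have hexp : 1 ≤ Real.exp l := Real.one_le_exp (by linarith)
    have : 0 ≤ Real.log (2 * Real.exp l * k) := Real.log_nonneg (by nlinarith)
    positivity
  have hsum := Summable.of_nonneg_of_le hnn hle hs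
  refine ⟨hsum, (hsum.tsum_le_tsum hle hs).trans ?_⟩
  rw [tsum_mul_left]
  calc _ ≤ 24 * J.factorial / δ^J * (2/(δ/J)) := by
        gcongr; exact tsum_pow_le hδJ hδJ1
    _ = _ := by rw [pow_succ]; field_simp; ring
end CInf

namespace CInf
open Complex Filter Topology MeasureTheory Asymptotics DirichletCharacter
open ArithmeticFunction vonMangoldt

open Classical in
/-- sifted prime summand -/
noncomputable def gf (d : ℕ) (S : Finset ℕ) (δ : ℝ) (j : ℕ) (n : ℕ) : ℝ :=
  if n.Prime ∧ d ∣ n - 1 ∧ ∀ q ∈ S, ¬ d * q ∣ n - 1 then Real.log n ^ (j+1) * (n:ℝ)^(-(1+δ)) else 0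

lemma zmod_iff {d n : ℕ} (hn : 1 ≤ n) : (n : ZMod d) = 1 ↔ d ∣ n - 1 := by
  rw [← Nat.modEq_iff_dvd' hn, ← ZMod.natCast_eq_natCast_iff, Nat.cast_one, eq_comm]

lemma tf_prime {d n : ℕ} {δ : ℝ} {j : ℕ} (hn : n.Prime) (h : d ∣ n - 1) :
    tf d δ j n = Real.log n ^ (j+1) * (n:ℝ)^(-(1+δ)) := by
  have : (n : ZMod d) = 1 := (zmod_iff hn.one_le).mpr h
  rw [tf, residueClass, Set.indicator_of_mem (by exact this), vonMangoldt_apply_prime hn]; ring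

lemma tf_nonneg (d : ℕ) (δ : ℝ) (j n : ℕ) : 0 ≤ tf d δ j n := by
  unfold tf
  have := residueClass_nonneg (1 : ZMod d) n
  have h2 := Real.log_natCast_nonneg n
  positivity

lemma gf_nonneg (d : ℕ) (S : Finset ℕ) (δ : ℝ) (j n : ℕ) : 0 ≤ gf d S δ j n := by
  unfold gf
  have h2 := Real.log_natCast_nonneg n
  split_ifs <;> positivity

lemma gf_le (d : ℕ) (S : Finset ℕ) (δ : ℝ) (j n : ℕ) : gf d S δ j n ≤ tf d δ j n := by
  unfold gf
  split_ifs with h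
  · rw [tf_prime h.1 h.2.1]
  · exact tf_nonneg _ _ _ _

lemma tf_zero (d : ℕ) (δ : ℝ) (j : ℕ) : tf d δ j 0 = 0 := by
  unfold tf; rw [residueClass_apply_zero]; ring

lemma tf_split (d : ℕ) (S : Finset ℕ) {δ : ℝ} (hδ : 0 < δ) (j n : ℕ) :
    tf d δ j n ≤ gf d S δ j n + ∑ q ∈ S, tf (d*q) δ j n + j.factorial * 4^j * h0 n := by
  have a1 := gf_nonneg d S δ j n
  have a2 : 0 ≤ ∑ q ∈ S, tf (d*q) δ j n := Finset.sum_nonneg fun q _ => tf_nonneg _ _ _ _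
  have a3 : 0 ≤ j.factorial * 4^j * h0 n := mul_nonneg (by positivity) (h0_nonneg n)
  rcases Nat.eq_zero_or_pos n with rfl | hn
  · rw [tf_zero]; linarith
  have hn1 : (1:ℝ) ≤ n := by exact_mod_cast hn
  by_cases hp : n.Prime
  · by_cases hd : d ∣ n - 1
    · by_cases hq : ∃ q ∈ S, d * q ∣ n - 1
      · obtain ⟨q, hq, hq2⟩ := hq
        have : tf (d*q) δ j n ≤ ∑ q ∈ S, tf (d*q) δ j n :=
          Finset.single_le_sum (f := fun q => tf (d*q) δ j n) (fun q _ => tf_nonneg _ _ _ _) hq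
        rw [tf_prime hp hq2] at this
        rw [tf_prime hp hd]; linarith
      · push Not at hq
        have : gf d S δ j n = Real.log n ^ (j+1) * (n:ℝ)^(-(1+δ)) := by
          rw [gf, if_pos ⟨hp, hd, hq⟩]
        rw [tf_prime hp hd]; linarith
    · have : (n : ZMod d) ≠ 1 := fun h => hd ((zmod_iff hn).mp h)
      have : tf d δ j n = 0 := by
        rw [tf, residueClass, Set.indicator_of_notMem (by exact this)]; ring
      linarith
  · have h1 : tf d δ j n ≤ j.factorial * 4^j * h0 n := by
      rw [tf, h0, if_neg hp]
      have h2 := residueClass_le (1 : ZMod d) n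
      have h3 := log_pow_le hn1 (η := 1/4) (by norm_num) j
      have h3' : Real.log n ^ j ≤ j.factorial * 4^j * (n:ℝ)^(1/4:ℝ) := by
        refine h3.trans (le_of_eq ?_)
        rw [one_div_pow]; field_simp
      have h4 : (n:ℝ)^(-(1+δ)) ≤ (n:ℝ)^(-1:ℝ) := Real.rpow_le_rpow_of_exponent_le hn1 (by linarith)
      have h5 : (0:ℝ) ≤ vonMangoldt n := vonMangoldt_nonneg
      have h6 := Real.log_natCast_nonneg n
      calc _ ≤ vonMangoldt n * (j.factorial * 4^j * (n:ℝ)^(1/4:ℝ)) * (n:ℝ)^(-1:ℝ) := by gcongr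
        _ = j.factorial * 4^j * (vonMangoldt n * ((n:ℝ)^(1/4:ℝ) * (n:ℝ)^(-1:ℝ))) := by ring
        _ = _ := by rw [← Real.rpow_add (by linarith)]; congr 3; norm_num
    linarith

lemma low : ∃ l0 : ℝ, 4 ≤ l0 ∧ ∀ l, l0 ≤ l → ∀ (d : ℕ) (S : Finset ℕ), 1 ≤ d →
    (∀ q ∈ S, q.Prime) → ∑ q ∈ S, 1/((q:ℝ)-1) ≤ 1/4 →
    Real.log d ≤ l → ¬ Bad l d → (∀ q ∈ S, Real.log (d*q:ℕ) ≤ l ∧ ¬ Bad l (d*q)) →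
    ∀ j : ℕ, 2*l ≤ j → 1/2 * (j.factorial / (xx l/16)^(j+1)) ≤ d * ∑' n, gf d S (xx l/16) j n := by
  obtain ⟨l0, hl0, hmain⟩ := main_est
  refine ⟨max l0 (∑' n, h0 n), hl0.trans (le_max_left _ _), ?_⟩
  intro l hl d S hd hS hsum hdl hdb hq j hj
  have hl0' := (le_max_left _ _).trans hl
  have hC := (le_max_right _ _).trans hl
  have hl4 := hl0.trans hl0'
  have hx := xx_pos hl4
  have hxe := xx_eq hl4
  set δ := xx l / 16 with hδ
  have hδ0 : 0 < δ := by positivity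
  set M : ℝ := j.factorial / δ^(j+1) with hM
  have hM0 : 0 < M := by positivity
  have : NeZero d := ⟨by omega⟩
  have hφ : (0:ℝ) < d.totient := by exact_mod_cast Nat.totient_pos.mpr hd
  have hφd : (d.totient:ℝ) ≤ d := by exact_mod_cast Nat.totient_le d
  have hφe : (d.totient : ℝ) ≤ Real.exp l := by
    have h0 : (0:ℝ) < d := by exact_mod_cast hd
    exact hφd.trans ((Real.log_le_iff_le_exp h0).mp hdl)
  have hsd := tf_summable d hδ0 j
  have hsg : Summable (gf d S δ j) := Summable.of_nonneg_of_le (gf_nonneg d S δ j) (gf_le d S δ j) hsd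
  have hsq : ∀ q ∈ S, Summable (tf (d*q) δ j) := fun q hq' => by
    have : NeZero (d*q) := ⟨mul_ne_zero (by omega) (hS q hq').ne_zero⟩
    exact tf_summable (d*q) hδ0 j
  have hsS : Summable (fun n => ∑ q ∈ S, tf (d*q) δ j n) := summable_sum hsq
  have hsh := h0_summable.mul_left (j.factorial * 4^j : ℝ)
  have h1 : ∑' n, tf d δ j n ≤ ∑' n, gf d S δ j n + ∑ q ∈ S, ∑' n, tf (d*q) δ j n + j.factorial * 4^j * ∑' n, h0 n := by
    rw [← Summable.tsum_finsetSum hsq, ← tsum_mul_left, ← hsg.tsum_add hsS, ← (hsg.add hsS).tsum_add hsh]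
    exact hsd.tsum_le_tsum (tf_split d S hδ0 j) ((hsg.add hsS).add hsh)
  have h2 : 99/100 * M ≤ d.totient * ∑' n, tf d δ j n := by
    have := (abs_le.mp (hmain l hl0' d hdl hdb j (by linarith))).1
    linarith
  have h3 : d.totient * ∑ q ∈ S, ∑' n, tf (d*q) δ j n ≤ 101/400 * M := by
    rw [Finset.mul_sum]
    calc _ ≤ ∑ q ∈ S, 101/100 * M * (1/((q:ℝ)-1)) := by
          apply Finset.sum_le_sum
          intro q hq'
          have : NeZero (d*q) := ⟨mul_ne_zero (by omega) (hS q hq').ne_zero⟩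
          have h4 := (abs_le.mp (hmain l hl0' (d*q) (hq q hq').1 (hq q hq').2 j (by linarith))).2
          have h5 : (d.totient:ℝ) * ((q:ℝ)-1) ≤ (d*q).totient := by
            have := Nat.totient_super_multiplicative d q
            rw [Nat.totient_prime (hS q hq')] at this
            have h6 : ((q-1:ℕ):ℝ) = (q:ℝ)-1 := by rw [Nat.cast_sub (hS q hq').one_le]; simp
            rw [← h6]; exact_mod_cast this
          have h7 : (0:ℝ) < (q:ℝ)-1 := by
            have : (2:ℝ) ≤ q := by exact_mod_cast (hS q hq').two_le
            linarith
          have h8 : 0 ≤ ∑' n, tf (d*q) δ j n := tsum_nonneg (tf_nonneg _ _ _)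
          rw [mul_one_div, le_div_iff₀ h7]
          calc _ = (d.totient:ℝ) * ((q:ℝ)-1) * ∑' n, tf (d*q) δ j n := by ring
            _ ≤ (d*q).totient * ∑' n, tf (d*q) δ j n := by gcongr
            _ ≤ _ := by linarith
      _ = 101/100 * M * ∑ q ∈ S, 1/((q:ℝ)-1) := by rw [Finset.mul_sum]
      _ ≤ 101/100 * M * (1/4) := by gcongr
      _ = _ := by ring
  have h4 : d.totient * (j.factorial * 4^j * ∑' n, h0 n) ≤ 1/5 * M := by
    have e1 : (1:ℝ)/5 * M = j.factorial * (1/5/δ^(j+1)) := by rw [hM]; ring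
    have e2 : d.totient * (j.factorial * 4^j * ∑' n, h0 n) = j.factorial * (d.totient * 4^j * ∑' n, h0 n) := by ring
    rw [e1, e2]
    apply mul_le_mul_of_nonneg_left _ (by positivity)
    rw [le_div_iff₀ (by positivity)]
    have hh0 : 0 ≤ ∑' n, h0 n := tsum_nonneg h0_nonneg
    have hl9 : 1 ≤ l^9 := one_le_pow₀ (by linarith)
    have hxs : xx l ≤ 1/216^5 := by
      rw [le_div_iff₀ (by norm_num)]; nlinarith
    have h4δ : 4*δ ≤ Real.exp (-2) := by
      have : (1:ℝ)/9 ≤ Real.exp (-2) := by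
        rw [Real.exp_neg, ← one_div]
        apply one_div_le_one_div_of_le (Real.exp_pos _)
        calc Real.exp 2 = Real.exp 1 ^ 2 := by rw [← Real.exp_nat_mul]; norm_num
          _ ≤ 2.7182818286^2 := by gcongr; exact Real.exp_one_lt_d9.le
          _ ≤ 9 := by norm_num
      have : (1:ℝ)/216^5 ≤ 1/9 := by norm_num
      rw [hδ]; linarith
    have hexpl : l ≤ Real.exp l := by linarith [Real.add_one_le_exp l]
    have hδ5 : δ ≤ 1/5 := by
      have : (1:ℝ)/216^5 ≤ 1/5 := by norm_num
      rw [hδ]; linarith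
    calc _ = d.totient * (∑' n, h0 n) * (4*δ)^j * δ := by rw [pow_succ, mul_pow]; ring
      _ ≤ Real.exp l * Real.exp l * (Real.exp (-2))^j * (1/5) := by
          gcongr; linarith
      _ ≤ Real.exp (2*l) * Real.exp (-(2*l)) * (1/5) := by
          rw [← Real.exp_add, ← Real.exp_nat_mul, show l + l = 2*l by ring]
          gcongr; nlinarith
      _ = 1/5 := by rw [← Real.exp_add]; simp
  have h5 : 1/2 * M ≤ d.totient * ∑' n, gf d S δ j n := by
    have := mul_le_mul_of_nonneg_left h1 hφ.le
    nlinarith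
  have h6 : 0 ≤ ∑' n, gf d S δ j n := tsum_nonneg (gf_nonneg _ _ _ _)
  exact h5.trans (by gcongr)
end CInf

namespace CInf
open Complex Filter Topology MeasureTheory Asymptotics DirichletCharacter

open Classical in
/-- indicator -/
noncomputable def ik (S : Finset ℕ) (d k : ℕ) : ℝ :=
  if (d*k+1).Prime ∧ ∀ q ∈ S, ¬ q ∣ k then 1 else 0

lemma ik_nonneg (S : Finset ℕ) (d k : ℕ) : 0 ≤ ik S d k := by unfold ik; split_ifs <;> norm_num
lemma ik_le (S : Finset ℕ) (d k : ℕ) : ik S d k ≤ 1 := by unfold ik; split_ifs <;> norm_num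

/-- weight -/
noncomputable def wt (l δ : ℝ) (J k : ℕ) : ℝ := Real.log (2 * Real.exp l * k) ^ J * (k:ℝ)^(-(1+δ))

lemma lg_nonneg {l : ℝ} (hl : 4 ≤ l) (k : ℕ) : 0 ≤ Real.log (2 * Real.exp l * k) := by
  rcases Nat.eq_zero_or_pos k with rfl | hk
  · simp
  have hk1 : (1:ℝ) ≤ k := by exact_mod_cast hk
  have hexp : 1 ≤ Real.exp l := Real.one_le_exp (by linarith)
  exact Real.log_nonneg (by nlinarith)

lemma wt_nonneg {l : ℝ} (hl : 4 ≤ l) (δ : ℝ) (J k : ℕ) : 0 ≤ wt l δ J k := by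
  have := lg_nonneg hl k
  unfold wt; positivity

lemma gf_ik {l δ : ℝ} (hl : 4 ≤ l) (hδ : 0 < δ) {d : ℕ} (hd : 1 ≤ d) (hdl : Real.log d ≤ l) (S : Finset ℕ) (j k : ℕ) :
    d * gf d S δ j (d*k+1) ≤ ik S d k * wt l δ (j+1) k := by
  have hd0 : (0:ℝ) < d := by exact_mod_cast hd
  rcases Nat.eq_zero_or_pos k with rfl | hk
  · have : gf d S δ j (d*0+1) = 0 := by
      rw [gf, if_neg]; simp [Nat.not_prime_one]
    rw [this, mul_zero]; exact mul_nonneg (ik_nonneg _ _ _) (wt_nonneg hl _ _ _)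
  by_cases h : (d*k+1).Prime ∧ ∀ q ∈ S, ¬ q ∣ k
  · have h' : (d*k+1).Prime ∧ d ∣ (d*k+1) - 1 ∧ ∀ q ∈ S, ¬ d * q ∣ (d*k+1) - 1 := by
      refine ⟨h.1, by simp, fun q hq hdv => h.2 q hq ?_⟩
      rw [Nat.add_sub_cancel] at hdv
      exact Nat.dvd_of_mul_dvd_mul_left hd hdv
    rw [gf, if_pos h', ik, if_pos h, one_mul, wt]
    have hk1 : (1:ℝ) ≤ k := by exact_mod_cast hk
    have hd1 : (1:ℝ) ≤ d := by exact_mod_cast hd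
    have hde : (d:ℝ) ≤ Real.exp l := (Real.log_le_iff_le_exp hd0).mp hdl
    have a1 : Real.log ((d*k+1:ℕ):ℝ) ≤ Real.log (2 * Real.exp l * k) := by
      apply Real.log_le_log (by positivity)
      push_cast; nlinarith
    have a2 : ((d*k+1:ℕ):ℝ)^(-(1+δ)) ≤ (d:ℝ)^(-1:ℝ) * (k:ℝ)^(-(1+δ)) := by
      calc ((d*k+1:ℕ):ℝ)^(-(1+δ)) ≤ ((d:ℝ)*k)^(-(1+δ)) := by
            apply Real.rpow_le_rpow_of_nonpos (by positivity) _ (by linarith)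
            push_cast; linarith
        _ = (d:ℝ)^(-(1+δ)) * (k:ℝ)^(-(1+δ)) := Real.mul_rpow (by positivity) (by positivity)
        _ ≤ _ := by
            gcongr ?_ * _
            exact Real.rpow_le_rpow_of_exponent_le hd1 (by linarith)
    have a3 : 0 ≤ Real.log ((d*k+1:ℕ):ℝ) := Real.log_natCast_nonneg _
    have a4 := lg_nonneg hl k
    calc _ ≤ d * (Real.log (2 * Real.exp l * k)^(j+1) * ((d:ℝ)^(-1:ℝ) * (k:ℝ)^(-(1+δ)))) := by gcongr
      _ = _ := by rw [Real.rpow_neg_one]; field_simp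
  · have h' : ¬ ((d*k+1).Prime ∧ d ∣ (d*k+1) - 1 ∧ ∀ q ∈ S, ¬ d * q ∣ (d*k+1) - 1) := by
      rintro ⟨h1, -, h3⟩
      exact h ⟨h1, fun q hq hdv => h3 q hq (by rw [Nat.add_sub_cancel]; exact Nat.mul_dvd_mul_left d hdv)⟩
    rw [gf, if_neg h', ik, if_neg h]; simp

lemma gf_tsum {d : ℕ} (hd : 1 ≤ d) (S : Finset ℕ) (δ : ℝ) (j : ℕ) :
    ∑' n, gf d S δ j n = ∑' k, gf d S δ j (d*k+1) := by
  have hinj : Function.Injective (fun k : ℕ => d*k+1) := by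
    intro a b hab
    simp only [Nat.add_right_cancel_iff] at hab
    exact Nat.eq_of_mul_eq_mul_left hd hab
  refine (hinj.tsum_eq (f := gf d S δ j) ?_).symm
  intro n hn
  rw [Function.mem_support, gf] at hn
  split_ifs at hn with h
  · obtain ⟨c, hc⟩ := h.2.1
    exact ⟨c, by have := h.1.pos; simp only; omega⟩
  · exact absurd rfl hn

lemma lemP : ∃ l0 : ℝ, 4 ≤ l0 ∧ ∀ l, l0 ≤ l → ∀ (D S : Finset ℕ), D.Nonempty →
    (∀ q ∈ S, q.Prime) → ∑ q ∈ S, 1/((q:ℝ)-1) ≤ 1/4 →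
    (∀ d ∈ D, 1 ≤ d ∧ Real.log d ≤ l ∧ ¬ Bad l d ∧ (∀ q ∈ S, Real.log (d*q:ℕ) ≤ l ∧ ¬ Bad l (d*q))) →
    ∃ k : ℕ, 1 ≤ k ∧ (∀ q ∈ S, ¬ q ∣ k) ∧
      D.card * Real.log (2 * Real.exp l * k) ≤ l^22 * (D.filter fun d => (d*k+1).Prime).card := by
  obtain ⟨l0, hl0, hlow⟩ := low
  refine ⟨max l0 (96*125*(16*216^5)^2), hl0.trans (le_max_left _ _), ?_⟩
  intro l hl D S hD hS hsum hd
  have hll := (le_max_left _ _).trans hl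
  have hlC := (le_max_right _ _).trans hl
  have hl4 := hl0.trans hll
  have hx := xx_pos hl4
  have hxe := xx_eq hl4
  have hxl := xx_le hl4
  set δ := xx l / 16 with hδ
  have hδ0 : 0 < δ := by positivity
  have hδl : δ * (l+1) ≤ 1 := by
    rw [le_div_iff₀ (by linarith)] at hxl; nlinarith
  set j := ⌈2*l⌉₊ with hj
  have hj1 : 2*l ≤ j := Nat.le_ceil _
  have hj2 : (j:ℝ) < 2*l+1 := Nat.ceil_lt_add_one (by linarith)
  have hjp : 2 ≤ j + 1 := by
    have : (1:ℝ) ≤ j := by linarith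
    have : 1 ≤ j := by exact_mod_cast this
    omega
  set M : ℝ := j.factorial / δ^(j+1) with hM
  have hM0 : 0 < M := by positivity
  have hs1 : Summable (wt l δ (j+1)) := (up_sum hl4 hδ0 hδl hjp).1
  obtain ⟨hs2, hb2⟩ := up_sum hl4 hδ0 hδl (J := j+2) (by omega)
  change Summable (wt l δ (j+2)) at hs2
  change ∑' k, wt l δ (j+2) k ≤ _ at hb2
  have hsi : ∀ d, Summable (fun k => ik S d k * wt l δ (j+1) k) := fun d =>
    Summable.of_nonneg_of_le (fun k => mul_nonneg (ik_nonneg _ _ _) (wt_nonneg hl4 _ _ _))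
      (fun k => mul_le_of_le_one_left (wt_nonneg hl4 _ _ _) (ik_le _ _ _)) hs1
  have hlo : ∀ d ∈ D, 1/2 * M ≤ ∑' k, ik S d k * wt l δ (j+1) k := by
    intro d hdD
    obtain ⟨h1, h2, h3, h4⟩ := hd d hdD
    refine (hlow l hll d S h1 hS hsum h2 h3 h4 j hj1).trans ?_
    rw [gf_tsum h1, ← tsum_mul_left]
    refine Summable.tsum_le_tsum (fun k => gf_ik hl4 hδ0 h1 h2 S j k) ?_ (hsi d)
    exact Summable.of_nonneg_of_le (fun k => mul_nonneg (Nat.cast_nonneg _) (gf_nonneg _ _ _ _ _)) (fun k => gf_ik hl4 hδ0 h1 h2 S j k) (hsi d)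
  have hcard : (0:ℝ) < D.card := by exact_mod_cast hD.card_pos
  by_contra hcon
  push Not at hcon
  have hpt : ∀ k, l^22 * ∑ d ∈ D, ik S d k * wt l δ (j+1) k ≤ D.card * wt l δ (j+2) k := by
    intro k
    have hrhs : 0 ≤ D.card * wt l δ (j+2) k := mul_nonneg hcard.le (wt_nonneg hl4 _ _ _)
    rcases Nat.eq_zero_or_pos k with rfl | hk
    · have : wt l δ (j+1) 0 = 0 := by simp [wt]
      simp only [this, mul_zero, Finset.sum_const_zero]; exact hrhs
    by_cases hc : ∀ q ∈ S, ¬ q ∣ k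
    · have h1 := hcon k hk hc
      have h2 : ∑ d ∈ D, ik S d k * wt l δ (j+1) k = (D.filter fun d => (d*k+1).Prime).card * wt l δ (j+1) k := by
        rw [← Finset.sum_mul]
        congr 1
        rw [Finset.card_filter]; push_cast
        refine Finset.sum_congr rfl fun d _ => ?_
        unfold ik
        by_cases hp : (d*k+1).Prime
        · rw [if_pos ⟨hp, hc⟩, if_pos hp]
        · rw [if_neg (fun h => hp h.1), if_neg hp]
      have h3 : wt l δ (j+2) k = Real.log (2 * Real.exp l * k) * wt l δ (j+1) k := by
        unfold wt; rw [pow_succ]; ring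
      rw [h2, h3, ← mul_assoc, ← mul_assoc]
      exact mul_le_mul_of_nonneg_right h1.le (wt_nonneg hl4 _ _ _)
    · have : ∀ d ∈ D, ik S d k * wt l δ (j+1) k = 0 := fun d _ => by
        rw [ik, if_neg (fun h => hc h.2), zero_mul]
      rw [Finset.sum_eq_zero this, mul_zero]; exact hrhs
  have hfin : l^22 * (D.card * (1/2*M)) ≤ D.card * (48 * (j+2:ℕ) * (j+2).factorial / δ^(j+2+1)) := by
    calc l^22 * (D.card * (1/2*M)) ≤ l^22 * ∑ d ∈ D, ∑' k, ik S d k * wt l δ (j+1) k := by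
          gcongr
          rw [← nsmul_eq_mul]
          exact Finset.card_nsmul_le_sum D _ _ hlo
      _ = ∑' k, l^22 * ∑ d ∈ D, ik S d k * wt l δ (j+1) k := by
          rw [tsum_mul_left, Summable.tsum_finsetSum (fun d _ => hsi d)]
      _ ≤ ∑' k, D.card * wt l δ (j+2) k := by
          exact Summable.tsum_le_tsum hpt ((summable_sum fun d _ => hsi d).mul_left _) (hs2.mul_left _)
      _ = D.card * ∑' k, wt l δ (j+2) k := tsum_mul_left
      _ ≤ _ := by gcongr
  have hfin2 : l^22 * (1/2*M) ≤ 48 * (j+2:ℕ) * (j+2).factorial / δ^(j+2+1) := by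
    have e : l^22 * (D.card * (1/2*M)) = D.card * (l^22 * (1/2*M)) := by ring
    rw [e] at hfin
    exact le_of_mul_le_mul_left hfin hcard
  have hδi : 1/δ = 16*216^5*l^9 := by
    rw [div_eq_iff hδ0.ne', hδ]; linear_combination -hxe
  have e2 : 48 * (j+2:ℕ) * (j+2).factorial / δ^(j+2+1) = 48 * ((j:ℝ)+2)*((j+2)*(j+1)) * (1/δ)^2 * M := by
    rw [hM, Nat.factorial_succ, Nat.factorial_succ]; push_cast; field_simp; ring
  rw [e2, hδi] at hfin2
  have hfin3 : l^22 * (1/2) ≤ 48 * ((j:ℝ)+2)*((j+2)*(j+1)) * (16*216^5*l^9)^2 := by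
    have e : l^22 * (1/2*M) = l^22 * (1/2) * M := by ring
    rw [e] at hfin2
    exact le_of_mul_le_mul_right hfin2 hM0
  have hjl : (j:ℝ)+2 ≤ 4*l := by linarith
  have hfin4 : l^22 * (1/2) ≤ 48 * (4*l)*((4*l)*(4*l)) * (16*216^5*l^9)^2 := by
    refine hfin3.trans ?_
    gcongr
    linarith
  have h21 : 0 < l^21 := by positivity
  have : l * (1/2) ≤ 48 * 64 * (16*216^5)^2 := by
    refine le_of_mul_le_mul_right (a := l^21) ?_ h21
    calc _ = l^22 * (1/2) := by ring
      _ ≤ _ := hfin4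
      _ = _ := by ring
  have h5 : (96*125*(16*216^5)^2 : ℝ) * (1/2) ≤ 48 * 64 * (16*216^5)^2 := by linarith
  norm_num at h5
end CInf

namespace CInf
open Finset

/-- all relevant moduli are good -/
def Gd (l : ℝ) (u : ℕ) (S : Finset ℕ) : Prop :=
  ∀ T ∈ S.powersetCard u, ¬ Bad l (∏ q ∈ T, q) ∧ ∀ q ∈ S, ¬ Bad l ((∏ q ∈ T, q) * q)

lemma dvd_prod_mem {S : Finset ℕ} (hS : ∀ q ∈ S, q.Prime) {p : ℕ} (hp : p.Prime) (h : p ∣ ∏ q ∈ S, q) : p ∈ S := by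
  obtain ⟨q, hq, hd⟩ := (hp.prime.dvd_finsetProd_iff _).mp h
  rwa [(Nat.prime_dvd_prime_iff_eq hp (hS q hq)).mp hd]

lemma log_prod_le {T : Finset ℕ} {u : ℕ} {l : ℝ} (hT : T.card = u) (h : ∀ q ∈ T, q.Prime)
    (hl : ∀ q ∈ T, ((u:ℝ)+1) * Real.log q ≤ l) : ((u:ℝ)+1) * Real.log ((∏ q ∈ T, q : ℕ):ℝ) ≤ u * l := by
  push_cast
  rw [Real.log_prod (fun q hq => by exact_mod_cast (h q hq).ne_zero), Finset.mul_sum]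
  refine (Finset.sum_le_card_nsmul _ _ l hl).trans ?_
  rw [hT, nsmul_eq_mul]

lemma mod_log {S T : Finset ℕ} {u : ℕ} {l : ℝ} (hl0 : 0 ≤ l) (hT : T ∈ S.powersetCard u) (h : ∀ q ∈ S, q.Prime)
    (hl : ∀ q ∈ S, ((u:ℝ)+1) * Real.log q ≤ l) :
    1 ≤ ∏ q ∈ T, q ∧ Real.log ((∏ q ∈ T, q : ℕ):ℝ) ≤ l ∧ ∀ q ∈ S, Real.log (((∏ q ∈ T, q) * q : ℕ):ℝ) ≤ l := by
  obtain ⟨hTS, hTc⟩ := mem_powersetCard.mp hT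
  have h1 := log_prod_le hTc (fun q hq => h q (hTS hq)) (fun q hq => hl q (hTS hq))
  have hpos : 0 < ∏ q ∈ T, q := Finset.prod_pos fun q hq => (h q (hTS hq)).pos
  have hu : (0:ℝ) < (u:ℝ)+1 := by positivity
  refine ⟨hpos, ?_, fun q hq => ?_⟩
  · refine le_of_mul_le_mul_left ?_ hu; linarith
  · have h2 := hl q hq
    rw [Nat.cast_mul, Real.log_mul (by exact_mod_cast hpos.ne') (by exact_mod_cast (h q hq).ne_zero)]
    refine le_of_mul_le_mul_left ?_ hu; linarith

lemma not_Gd {S : Finset ℕ} {u : ℕ} {l : ℝ} (hl0 : 0 ≤ l) (h : ∀ q ∈ S, q.Prime)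
    (hl : ∀ q ∈ S, ((u:ℝ)+1) * Real.log q ≤ l) (hb : ¬ Gd l u S) :
    ∃ m : ℕ, Bad l m ∧ Real.log m ≤ l ∧ ∀ p, p.Prime → p ∣ m → p ∈ S := by
  unfold Gd at hb
  push Not at hb
  obtain ⟨T, hT, hTb⟩ := hb
  obtain ⟨hTS, hTc⟩ := mem_powersetCard.mp hT
  obtain ⟨a1, a2, a3⟩ := mod_log hl0 hT h hl
  have hpd : ∀ p, p.Prime → p ∣ ∏ q ∈ T, q → p ∈ S := fun p hp hd =>
    hTS (dvd_prod_mem (fun q hq => h q (hTS hq)) hp hd)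
  by_cases hB : Bad l (∏ q ∈ T, q)
  · exact ⟨_, hB, a2, hpd⟩
  · obtain ⟨q, hq, hB2⟩ := hTb hB
    refine ⟨_, hB2, a3 q hq, fun p hp hd => ?_⟩
    rcases hp.dvd_mul.mp hd with hd | hd
    · exact hpd p hp hd
    · rwa [(Nat.prime_dvd_prime_iff_eq hp (h q hq)).mp hd]

lemma lemQ : ∃ l0 : ℝ, 4 ≤ l0 ∧ ∀ l, l0 ≤ l → ∀ (S : Finset ℕ) (N u : ℕ), S.card = 2*N → u ≤ N →
    (∀ q ∈ S, q.Prime) → ∑ q ∈ S, 1/((q:ℝ)-1) ≤ 1/4 → (∀ q ∈ S, ((u:ℝ)+1) * Real.log q ≤ l) →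
    ∃ S' ⊆ S, S'.card = N ∧ ∃ k : ℕ, 1 ≤ k ∧ (∀ q ∈ S', ¬ q ∣ k) ∧ Real.log k ≤ l^22 ∧
      (N.choose u : ℝ) ≤ l^22 * ((S'.powersetCard u).filter fun T => ((∏ q ∈ T, q)*k+1).Prime).card := by
  obtain ⟨l0, hl0, hP⟩ := lemP
  refine ⟨l0, hl0, ?_⟩
  intro l hl S N u hSc hu hS hsum hlog
  have hl4 := hl0.trans hl
  have hlz : 0 ≤ l := by linarith
  obtain ⟨S1, hS1, hS1c⟩ := exists_subset_card_eq (s := S) (n := N) (by omega)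
  have hS2c : (S \ S1).card = N := by rw [card_sdiff_of_subset hS1]; omega
  have hS2 : S \ S1 ⊆ S := sdiff_subset
  have hG : ∃ S' ⊆ S, S'.card = N ∧ Gd l u S' := by
    by_contra hcon
    push Not at hcon
    have b1 := hcon S1 hS1 hS1c
    have b2 := hcon _ hS2 hS2c
    obtain ⟨m1, hb1, hm1, hp1⟩ := not_Gd hlz (fun q hq => hS q (hS1 hq)) (fun q hq => hlog q (hS1 hq)) b1
    obtain ⟨m2, hb2, hm2, hp2⟩ := not_Gd hlz (fun q hq => hS q (hS2 hq)) (fun q hq => hlog q (hS2 hq)) b2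
    refine bad_coprime hl4 ?_ hm1 hm2 hb1 hb2
    refine Nat.coprime_of_dvd fun p hp h1 h2 => ?_
    exact (mem_sdiff.mp (hp2 p hp h2)).2 (hp1 p hp h1)
  obtain ⟨S', hS', hS'c, hg⟩ := hG
  refine ⟨S', hS', hS'c, ?_⟩
  have hinj : Set.InjOn (fun T : Finset ℕ => ∏ q ∈ T, q) (S'.powersetCard u : Set (Finset ℕ)) := by
    intro T hT T' hT' he
    have h1 := (mem_powersetCard.mp (mem_coe.mp hT)).1
    have h2 := (mem_powersetCard.mp (mem_coe.mp hT')).1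
    rw [← Nat.primeFactors_prod (fun q hq => hS q (hS' (h1 hq))), ← Nat.primeFactors_prod (fun q hq => hS q (hS' (h2 hq)))]
    exact congrArg Nat.primeFactors he
  have hne : (S'.powersetCard u).Nonempty := powersetCard_nonempty.mpr (by omega)
  obtain ⟨k, hk, hkq, hkc⟩ := hP l hl ((S'.powersetCard u).image fun T => ∏ q ∈ T, q) S' (hne.image _)
    (fun q hq => hS q (hS' hq))
    ((Finset.sum_le_sum_of_subset_of_nonneg hS' fun q hq _ => by
      have : (2:ℝ) ≤ q := by exact_mod_cast (hS q hq).two_le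
      exact one_div_nonneg.mpr (by linarith)).trans hsum) (by
      intro d hd
      obtain ⟨T, hT, rfl⟩ := mem_image.mp hd
      obtain ⟨a1, a2, a3⟩ := mod_log hlz hT (fun q hq => hS q (hS' hq)) (fun q hq => hlog q (hS' hq))
      exact ⟨a1, a2, (hg T hT).1, fun q hq => ⟨a3 q hq, (hg T hT).2 q hq⟩⟩)
  rw [filter_image, card_image_of_injOn hinj, card_image_of_injOn (hinj.mono (by exact_mod_cast filter_subset _ _)), card_powersetCard, hS'c] at hkc
  have hk1 : (1:ℝ) ≤ k := by exact_mod_cast hk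
  have hexp : 1 ≤ Real.exp l := Real.one_le_exp (by linarith)
  have elog : Real.log (2 * Real.exp l * k) = Real.log 2 + l + Real.log k := by
    rw [Real.log_mul (by positivity) (by positivity), Real.log_mul (by norm_num) (by positivity), Real.log_exp]
  have hk0 : 0 ≤ Real.log k := Real.log_natCast_nonneg k
  have h20 : 0 ≤ Real.log 2 := Real.log_nonneg (by norm_num)
  have hch : (0:ℝ) < N.choose u := by exact_mod_cast Nat.choose_pos hu
  have hle : (((S'.powersetCard u).filter fun T => ((∏ q ∈ T, q)*k+1).Prime).card : ℝ) ≤ N.choose u := by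
    have := card_filter_le (S'.powersetCard u) (fun T => ((∏ q ∈ T, q)*k+1).Prime)
    rw [card_powersetCard, hS'c] at this
    exact_mod_cast this
  refine ⟨k, hk, hkq, ?_, ?_⟩
  · have h1 : (N.choose u:ℝ) * Real.log (2 * Real.exp l * k) ≤ N.choose u * l^22 := by
      refine hkc.trans ?_
      rw [mul_comm]; gcongr
    have := le_of_mul_le_mul_left h1 hch
    linarith
  · refine le_trans ?_ hkc
    apply le_mul_of_one_le_right hch.le
    linarith
end CInf

namespace CInf
open Finset

section grp
variable {G : Type} [AddCommGroup G] [Fintype G] {ι : Type} [DecidableEq ι]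

open Classical in
lemma greedy {e : ℕ} (he : 1 ≤ e) (hG : ∀ x : G, e • x = 0) (g : ι → G) (I : Finset ι) :
    ∃ a : ι → ℂ, (∀ i ∈ I, a i ≠ 0) ∧
      (((univ : Finset (AddChar G ℂ)).filter fun ψ => ∀ i ∈ I, ψ (g i) ≠ a i).card : ℝ)
        ≤ (1 - 1/(e:ℝ))^I.card * Fintype.card G := by
  induction I using Finset.induction_on with
  | empty =>
    refine ⟨fun _ => 1, by simp, ?_⟩
    simp [AddChar.card_eq]
  | insert i I hi ih =>
    obtain ⟨a, ha0, ha⟩ := ih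
    set R := (univ : Finset (AddChar G ℂ)).filter fun ψ => ∀ i ∈ I, ψ (g i) ≠ a i with hR
    have he0 : (0:ℝ) < e := by exact_mod_cast he
    have hmap : ∀ ψ ∈ R, ψ (g i) ∈ Polynomial.nthRootsFinset e (1:ℂ) := by
      intro ψ _
      rw [Polynomial.mem_nthRootsFinset he, ← AddChar.map_nsmul_eq_pow, hG, AddChar.map_zero_eq_one]
    have hex : ∃ ζ ∈ Polynomial.nthRootsFinset e (1:ℂ), (R.card:ℝ)/e ≤ ((R.filter fun ψ => ψ (g i) = ζ).card : ℝ) := by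
      by_contra hcon
      push Not at hcon
      have h1 : R.card = ∑ ζ ∈ Polynomial.nthRootsFinset e (1:ℂ), (R.filter fun ψ => ψ (g i) = ζ).card :=
        card_eq_sum_card_fiberwise hmap
      have hne : (Polynomial.nthRootsFinset e (1:ℂ)).Nonempty :=
        ⟨1, by rw [Polynomial.mem_nthRootsFinset he]; simp⟩
      have h2 := Finset.sum_lt_sum_of_nonempty hne hcon
      rw [← Nat.cast_sum, ← h1, sum_const, nsmul_eq_mul] at h2
      have h3 : ((Polynomial.nthRootsFinset e (1:ℂ)).card : ℝ) ≤ e := by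
        have : (Polynomial.nthRootsFinset e (1:ℂ)).card ≤ e := by
          rw [Polynomial.nthRootsFinset_def]
          exact (Multiset.toFinset_card_le _).trans (Polynomial.card_nthRoots e 1)
        exact_mod_cast this
      have h4 : ((Polynomial.nthRootsFinset e (1:ℂ)).card : ℝ) * (R.card/e) ≤ e * (R.card/e) := by gcongr
      rw [mul_div_cancel₀ _ he0.ne'] at h4
      linarith
    obtain ⟨ζ, hζ, hc⟩ := hex
    refine ⟨Function.update a i ζ, ?_, ?_⟩
    · intro k hk
      by_cases hki : k = i
      · subst hki
        rw [Function.update_self]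
        rintro rfl
        rw [Polynomial.mem_nthRootsFinset he, zero_pow (by omega)] at hζ
        exact zero_ne_one hζ
      · rw [Function.update_of_ne hki]
        exact ha0 k ((mem_insert.mp hk).resolve_left hki)
    · have hsub : ((univ : Finset (AddChar G ℂ)).filter fun ψ => ∀ k ∈ insert i I, ψ (g k) ≠ Function.update a i ζ k)
          = R.filter fun ψ => ¬ (ψ (g i) = ζ) := by
        ext ψ
        simp only [hR, mem_filter, mem_univ, true_and, forall_mem_insert, Function.update_self]
        have : (∀ k ∈ I, ψ (g k) ≠ Function.update a i ζ k) ↔ ∀ k ∈ I, ψ (g k) ≠ a k := by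
          refine forall₂_congr fun k hk => ?_
          rw [Function.update_of_ne (by rintro rfl; exact hi hk)]
        rw [this]; tauto
      have hsum := card_filter_add_card_filter_not (s := R) (fun ψ => ψ (g i) = ζ)
      have hsum' : ((R.filter fun ψ => ψ (g i) = ζ).card:ℝ) + ((R.filter fun ψ => ¬ (ψ (g i) = ζ)).card:ℝ) = R.card := by
        exact_mod_cast hsum
      rw [hsub, card_insert_of_notMem hi, pow_succ]
      have h1e : 0 ≤ 1 - 1/(e:ℝ) := by
        rw [sub_nonneg, div_le_one he0]; exact_mod_cast he
      calc ((R.filter fun ψ => ¬ (ψ (g i) = ζ)).card:ℝ) ≤ (1 - 1/(e:ℝ)) * R.card := by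
            have : (1 - 1/(e:ℝ)) * R.card = R.card - R.card/e := by ring
            linarith
        _ ≤ (1 - 1/(e:ℝ)) * ((1 - 1/(e:ℝ))^I.card * Fintype.card G) := by gcongr
        _ = _ := by ring

lemma ac_sum (ψ : AddChar G ℂ) (g : ι → G) (T : Finset ι) : ψ (∑ i ∈ T, g i) = ∏ i ∈ T, ψ (g i) := by
  induction T using Finset.induction_on with
  | empty => simp
  | insert i T hi ih => rw [sum_insert hi, prod_insert hi, AddChar.map_add_eq_mul, ih]

open Classical in
lemma zero_sum {e : ℕ} (he : 1 ≤ e) (hG : ∀ x : G, e • x = 0) (g : ι → G) (I : Finset ι)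
    (hI : e * Real.log (Fintype.card G) < I.card) : ∃ T ⊆ I, T.Nonempty ∧ ∑ i ∈ T, g i = 0 := by
  obtain ⟨a, ha0, ha⟩ := greedy he hG g I
  have he0 : (0:ℝ) < e := by exact_mod_cast he
  have hGpos : (0:ℝ) < Fintype.card G := by exact_mod_cast Fintype.card_pos
  have hlt : (1 - 1/(e:ℝ))^I.card * Fintype.card G < 1 := by
    have h1e : 0 ≤ 1 - 1/(e:ℝ) := by
      rw [sub_nonneg, div_le_one he0]; exact_mod_cast he
    calc _ ≤ (Real.exp (-(1/(e:ℝ))))^I.card * Fintype.card G := by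
          gcongr; linarith [Real.add_one_le_exp (-(1/(e:ℝ)))]
      _ = Real.exp (-(I.card/(e:ℝ)) + Real.log (Fintype.card G)) := by
          rw [Real.exp_add, Real.exp_log hGpos, ← Real.exp_nat_mul]; ring_nf
      _ < 1 := by
          rw [Real.exp_lt_one_iff]
          have : Real.log (Fintype.card G) < I.card/(e:ℝ) := by rw [lt_div_iff₀ he0]; linarith
          linarith
  have hemp : ((univ : Finset (AddChar G ℂ)).filter fun ψ => ∀ i ∈ I, ψ (g i) ≠ a i) = ∅ := by
    rw [← card_eq_zero]
    exact Nat.lt_one_iff.mp (by exact_mod_cast (ha.trans_lt hlt))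
  by_contra hcon
  push Not at hcon
  have hz : ∑ ψ : AddChar G ℂ, ∏ i ∈ I, (ψ (g i) + -a i) = 0 := by
    apply sum_eq_zero
    intro ψ _
    have : ψ ∉ ((univ : Finset (AddChar G ℂ)).filter fun ψ => ∀ i ∈ I, ψ (g i) ≠ a i) := by rw [hemp]; simp
    simp only [mem_filter, mem_univ, true_and, not_forall, not_not] at this
    obtain ⟨i, hi, h⟩ := this
    exact prod_eq_zero hi (by rw [h]; ring)
  simp_rw [prod_add] at hz
  rw [sum_comm] at hz
  have hterm : ∀ T ∈ I.powerset, T ≠ ∅ → ∑ ψ : AddChar G ℂ, (∏ i ∈ T, ψ (g i)) * ∏ i ∈ I \ T, -a i = 0 := by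
    intro T hT hTne
    rw [← sum_mul]
    simp_rw [← ac_sum]
    rw [AddChar.sum_apply_eq_ite, if_neg (hcon T (mem_powerset.mp hT) (nonempty_iff_ne_empty.mpr hTne)), zero_mul]
  rw [sum_eq_single ∅ hterm (fun h => absurd (empty_mem_powerset I) h)] at hz
  simp only [prod_empty, one_mul, sdiff_empty, sum_const, card_univ, nsmul_eq_mul] at hz
  rw [AddChar.card_eq] at hz
  refine mul_ne_zero ?_ ?_ hz
  · exact_mod_cast Fintype.card_ne_zero
  · exact prod_ne_zero_iff.mpr fun i hi => neg_ne_zero.mpr (ha0 i hi)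
end grp

lemma grpL {L M : ℕ} (hL : 1 ≤ L) (hM : 1 ≤ M) (hx : ∀ x : (ZMod L)ˣ, x^M = 1) (P : Finset ℕ)
    (hP : ∀ p ∈ P, Nat.Coprime p L) (hc : 4 * M * Real.log (4*L) < P.card) :
    ∃ Q ⊆ P, Q.Nonempty ∧ 4 ∣ Q.card ∧ (∏ p ∈ Q, p) ≡ 1 [MOD L] := by
  have : NeZero L := ⟨by omega⟩
  let g : ℕ → Additive (ZMod L)ˣ × ZMod 4 := fun p =>
    (if h : Nat.Coprime p L then Additive.ofMul (ZMod.unitOfCoprime p h) else 0, 1)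
  obtain ⟨Q, hQ, hne, hs⟩ := zero_sum (G := Additive (ZMod L)ˣ × ZMod 4) (e := 4*M) (by omega) (by
    rintro ⟨x, y⟩
    refine Prod.ext ?_ ?_
    · change (4*M) • x = 0
      have h := hx (Additive.toMul x)
      rw [mul_comm, mul_nsmul]
      have h2 : M • x = 0 := h
      rw [h2, smul_zero]
    · change (4*M) • y = 0
      rw [nsmul_eq_mul]; push_cast
      rw [show (4 : ZMod 4) = 0 from rfl]; ring) g P (by
    refine lt_of_le_of_lt ?_ hc
    have h1 : (Fintype.card (Additive (ZMod L)ˣ × ZMod 4) : ℝ) ≤ 4*L := by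
      have h2 : Fintype.card (Additive (ZMod L)ˣ × ZMod 4) = L.totient * 4 := by
        rw [Fintype.card_prod, ZMod.card, Fintype.card_additive, ZMod.card_units_eq_totient]
      have h3 := Nat.totient_le L
      have h4 : Fintype.card (Additive (ZMod L)ˣ × ZMod 4) ≤ 4*L := by omega
      exact_mod_cast h4
    have h5 : (0:ℝ) < Fintype.card (Additive (ZMod L)ˣ × ZMod 4) := by exact_mod_cast Fintype.card_pos
    push_cast
    gcongr)
  refine ⟨Q, hQ, hne, ?_, ?_⟩
  · have h2 := congrArg Prod.snd hs
    rw [Prod.snd_sum] at h2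
    simp only [g, sum_const, nsmul_eq_mul, mul_one, Prod.snd_zero] at h2
    exact (ZMod.natCast_eq_zero_iff _ _).mp h2
  · have h1 := congrArg Prod.fst hs
    rw [Prod.fst_sum] at h1
    have h2 : ∏ p ∈ Q, Additive.toMul (g p).1 = 1 := by
      have := congrArg Additive.toMul h1
      rwa [toMul_sum] at this
    have h3 := congrArg (Units.val) h2
    rw [Units.coe_prod] at h3
    rw [← ZMod.natCast_eq_natCast_iff, Nat.cast_prod, Nat.cast_one, ← Units.val_one, ← h3]
    refine prod_congr rfl fun p hp => ?_
    simp only [g]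
    rw [dif_pos (hP p (hQ hp))]; simp
end CInf

namespace CInf
open Finset

lemma int_prod_dvd {Q : Finset ℕ} (hQ : ∀ p ∈ Q, p.Prime) {z : ℤ} (h : ∀ p ∈ Q, (p:ℤ) ∣ z) :
    ((∏ p ∈ Q, p : ℕ) : ℤ) ∣ z := by
  push_cast
  refine Finset.prod_dvd_of_coprime ?_ h
  intro p hp q hq hpq
  exact Nat.isCoprime_iff_coprime.mpr ((Nat.coprime_primes (hQ p hp) (hQ q hq)).mpr hpq)

lemma korselt {Q : Finset ℕ} (hQ : ∀ p ∈ Q, p.Prime) (hc : 2 ≤ Q.card)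
    (h : ∀ p ∈ Q, p - 1 ∣ (∏ p ∈ Q, p) - 1) : IsCarmichael (∏ p ∈ Q, p) := by
  set n := ∏ p ∈ Q, p with hn
  have hpf : n.primeFactors = Q := Nat.primeFactors_prod hQ
  have hn0 : 0 < n := Finset.prod_pos fun p hp => (hQ p hp).pos
  refine ⟨?_, ?_, ?_⟩
  · by_contra hlt
    have : n = 1 := by omega
    rw [this] at hpf
    simp at hpf
    rw [← hpf] at hc; simp at hc
  · intro hp
    rw [hp.primeFactors] at hpf
    rw [← hpf] at hc; simp at hc
  · intro a
    refine int_prod_dvd hQ fun p hp => ?_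
    have : Fact p.Prime := ⟨hQ p hp⟩
    obtain ⟨c, hcc⟩ := h p hp
    rw [← ZMod.intCast_eq_intCast_iff_dvd_sub]
    push_cast
    by_cases ha : (a : ZMod p) = 0
    · rw [ha, zero_pow hn0.ne']
    · have : n = (p-1)*c+1 := by omega
      rw [this, pow_succ, pow_mul, ZMod.pow_card_sub_one_eq_one ha, one_pow, one_mul]

lemma exp_dvd {S : Finset ℕ} (hS : ∀ q ∈ S, q.Prime) {M : ℕ} (hM : ∀ q ∈ S, q - 1 ∣ M)
    {L : ℕ} (hL : L = ∏ q ∈ S, q) (x : (ZMod L)ˣ) : x^M = 1 := by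
  have hL0 : 0 < L := hL ▸ Finset.prod_pos fun p hp => (hS p hp).pos
  have : NeZero L := ⟨hL0.ne'⟩
  apply Units.ext
  rw [Units.val_pow_eq_pow_val, Units.val_one]
  set a := (x : ZMod L).val with ha
  have hax : ((a:ℤ) : ZMod L) = x := by rw [ha]; simp
  have hcop : Nat.Coprime a L := ZMod.val_coe_unit_coprime x
  have hd : (L:ℤ) ∣ (a:ℤ)^M - 1 := by
    rw [hL]
    refine int_prod_dvd hS fun q hq => ?_
    have : Fact q.Prime := ⟨hS q hq⟩
    obtain ⟨c, hc⟩ := hM q hq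
    rw [← ZMod.intCast_eq_intCast_iff_dvd_sub]
    push_cast
    have h0 : (a : ZMod q) ≠ 0 := by
      intro h
      have h1 := (ZMod.natCast_eq_zero_iff _ _).mp h
      have h2 : q ∣ L := hL ▸ Finset.dvd_prod_of_mem _ hq
      exact (hS q hq).one_lt.ne' (Nat.dvd_one.mp (hcop ▸ Nat.dvd_gcd h1 h2))
    rw [hc, pow_mul, ZMod.pow_card_sub_one_eq_one h0, one_pow]
  rw [← ZMod.intCast_eq_intCast_iff_dvd_sub] at hd
  push_cast at hd
  rw [← hax]; push_cast; exact hd.symm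

lemma prod_inj {S : Finset ℕ} (hS : ∀ q ∈ S, q.Prime) {u k : ℕ} (hk : 1 ≤ k) :
    Set.InjOn (fun T : Finset ℕ => (∏ q ∈ T, q)*k+1) (S.powersetCard u : Set (Finset ℕ)) := by
  intro T hT T' hT' he
  have h1 := (mem_powersetCard.mp (mem_coe.mp hT)).1
  have h2 := (mem_powersetCard.mp (mem_coe.mp hT')).1
  rw [← Nat.primeFactors_prod (fun q hq => hS q (h1 hq)), ← Nat.primeFactors_prod (fun q hq => hS q (h2 hq))]
  simp only [Nat.add_right_cancel_iff] at he
  exact congrArg Nat.primeFactors (Nat.eq_of_mul_eq_mul_right hk he)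

lemma core {S : Finset ℕ} (hS : ∀ q ∈ S, q.Prime) {M k u : ℕ} (hM1 : 1 ≤ M) (hM : ∀ q ∈ S, q - 1 ∣ M)
    (hk : 1 ≤ k) (hkS : ∀ q ∈ S, ¬ q ∣ k)
    (hc : 4 * M * Real.log (4*(∏ q ∈ S, q : ℕ)) + S.card <
      ((S.powersetCard u).filter fun T => ((∏ q ∈ T, q)*k+1).Prime).card) :
    ∃ n, IsCarmichael n ∧ 1 < n.primeFactors.card ∧ ¬ (n.primeFactors.card).Prime ∧ 2^u ≤ n := by
  set L := ∏ q ∈ S, q with hL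
  set 𝒯 := (S.powersetCard u).filter fun T => ((∏ q ∈ T, q)*k+1).Prime with h𝒯
  have hL0 : 0 < L := Finset.prod_pos fun p hp => (hS p hp).pos
  set P := (𝒯.image fun T => (∏ q ∈ T, q)*k+1) \ S with hP
  have hPc : 4 * M * Real.log (4*L) < P.card := by
    have h1 : (𝒯.image fun T => (∏ q ∈ T, q)*k+1).card = 𝒯.card :=
      card_image_of_injOn ((prod_inj hS hk).mono (by exact_mod_cast filter_subset _ _))
    have h2 : (𝒯.image fun T => (∏ q ∈ T, q)*k+1).card - S.card ≤ P.card := le_card_sdiff S (𝒯.image fun T => (∏ q ∈ T, q)*k+1)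
    rw [h1] at h2
    have h3 : 𝒯.card ≤ P.card + S.card := by omega
    have h4 : (𝒯.card:ℝ) ≤ P.card + S.card := by exact_mod_cast h3
    linarith
  have hPp : ∀ p ∈ P, p.Prime ∧ p ∉ S ∧ ∃ T ∈ S.powersetCard u, p = (∏ q ∈ T, q)*k+1 := by
    intro p hp
    obtain ⟨h1, h2⟩ := mem_sdiff.mp hp
    obtain ⟨T, hT, rfl⟩ := mem_image.mp h1
    obtain ⟨h3, h4⟩ := mem_filter.mp hT
    exact ⟨h4, h2, T, h3, rfl⟩
  obtain ⟨Q, hQP, hne, h4, hmod⟩ := grpL (L := L) hL0 hM1 (exp_dvd hS hM hL) P (by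
    intro p hp
    obtain ⟨h1, h2, -⟩ := hPp p hp
    exact (Nat.Prime.coprime_iff_not_dvd h1).mpr fun hd => h2 (dvd_prod_mem hS h1 hd)) hPc
  have hQ : ∀ p ∈ Q, p.Prime := fun p hp => (hPp p (hQP hp)).1
  have hQ4 : 4 ≤ Q.card := Nat.le_of_dvd hne.card_pos h4
  have hmodk : (∏ p ∈ Q, p) ≡ 1 [MOD k] := by
    have : ∏ p ∈ Q, p ≡ ∏ p ∈ Q, 1 [MOD k] := by
      rw [← ZMod.natCast_eq_natCast_iff, Nat.cast_prod, Nat.cast_prod]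
      refine prod_congr rfl fun p hp => ?_
      obtain ⟨-, -, T, -, rfl⟩ := hPp p (hQP hp)
      push_cast; simp
    simpa using this
  have hcop : Nat.Coprime L k :=
    Nat.Coprime.prod_left fun q hq => (Nat.Prime.coprime_iff_not_dvd (hS q hq)).mpr (hkS q hq)
  have hn0 : 1 ≤ ∏ p ∈ Q, p := Finset.prod_pos fun p hp => (hQ p hp).pos
  have hLk : L * k ∣ (∏ p ∈ Q, p) - 1 :=
    hcop.mul_dvd_of_dvd_of_dvd ((Nat.modEq_iff_dvd' hn0).mp hmod.symm) ((Nat.modEq_iff_dvd' hn0).mp hmodk.symm)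
  have hpf : (∏ p ∈ Q, p).primeFactors = Q := Nat.primeFactors_prod hQ
  refine ⟨∏ p ∈ Q, p, korselt hQ (by omega) ?_, ?_, ?_, ?_⟩
  · intro p hp
    obtain ⟨-, -, T, hT, he⟩ := hPp p (hQP hp)
    rw [he, Nat.add_sub_cancel]
    refine dvd_trans (Nat.mul_dvd_mul_right ?_ k) hLk
    exact prod_dvd_prod_of_subset _ _ _ (mem_powersetCard.mp hT).1
  · rw [hpf]; omega
  · rw [hpf]; intro hpr
    have := (Nat.prime_dvd_prime_iff_eq Nat.prime_two hpr).mp (dvd_trans (by norm_num) h4)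
    omega
  · obtain ⟨p, hp⟩ := hne
    obtain ⟨-, -, T, hT, he⟩ := hPp p (hQP hp)
    obtain ⟨hT1, hT2⟩ := mem_powersetCard.mp hT
    have h1 : 2^u ≤ ∏ q ∈ T, q := by
      rw [← hT2]
      exact pow_card_le_prod T _ 2 fun q hq => (hS q (hT1 hq)).two_le
    have h2 : ∏ q ∈ T, q ≤ p := by rw [he]; nlinarith
    exact (h1.trans h2).trans (Nat.le_of_dvd hn0 (Finset.dvd_prod_of_mem _ hp))
end CInf

namespace CInf
open Finset

lemma choose_lb (u : ℕ) (hu : 1 ≤ u) : 3^u ≤ (4*u).choose u := by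
  have h := Nat.pow_le_choose (α := ℝ) u (4*u)
  have h1 : (u.factorial:ℝ) ≤ (u:ℝ)^u := by exact_mod_cast Nat.factorial_le_pow u
  have hu0 : (0:ℝ) < u := by exact_mod_cast hu
  rw [div_le_iff₀ (by positivity)] at h
  have h2 : (3:ℝ)^u * u^u ≤ (4*u).choose u * u^u := by
    calc (3:ℝ)^u * u^u = (3*u)^u := by rw [mul_pow]
      _ ≤ ((4*u+1-u:ℕ):ℝ)^u := by
          gcongr
          have : 3*u ≤ 4*u+1-u := by omega
          exact_mod_cast this
      _ ≤ ((4*u).choose u : ℝ) * u.factorial := by exact_mod_cast h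
      _ ≤ _ := by gcongr
  have h3 := le_of_mul_le_mul_right h2 (by positivity)
  exact_mod_cast h3

lemma bert (n : ℕ) : ∃ S : Finset ℕ, S.card = n ∧ (∀ q ∈ S, q.Prime) ∧ ∑ q ∈ S, 1/((q:ℝ)-1) ≤ 1/4 ∧
    ∀ q ∈ S, Real.log q ≤ n + 5 := by
  choose q hq hq1 hq2 using fun i : ℕ => Nat.exists_prime_lt_and_le_two_mul (2^(i+4)) (by positivity)
  have hmono : StrictMono q := strictMono_nat_of_lt_succ fun i => by
    have h1 := hq2 i
    have h2 := hq1 (i+1)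
    have e : 2^(i+1+4) = 2*2^(i+4) := by ring
    omega
  refine ⟨(range n).image q, ?_, ?_, ?_, ?_⟩
  · rw [card_image_of_injective _ hmono.injective, card_range]
  · intro p hp
    obtain ⟨i, -, rfl⟩ := mem_image.mp hp
    exact hq i
  · rw [sum_image hmono.injective.injOn]
    calc ∑ i ∈ range n, 1/((q i:ℝ)-1) ≤ ∑ i ∈ range n, 1/16 * (1/(2:ℝ))^i := by
          refine sum_le_sum fun i _ => ?_
          have e : 1/16 * (1/(2:ℝ))^i = 1/(2:ℝ)^(i+4) := by
            rw [one_div_pow, pow_add]; field_simp; norm_num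
          rw [e]
          apply one_div_le_one_div_of_le (by positivity)
          have : 2^(i+4) + 1 ≤ q i := hq1 i
          have : (2:ℝ)^(i+4) + 1 ≤ q i := by exact_mod_cast this
          linarith
      _ = 1/16 * ∑ i ∈ range n, (1/(2:ℝ))^i := by rw [mul_sum]
      _ ≤ 1/16 * 2 := by gcongr; exact sum_geometric_two_le n
      _ ≤ 1/4 := by norm_num
  · intro p hp
    obtain ⟨i, hi, rfl⟩ := mem_image.mp hp
    have hi' : (i:ℝ) ≤ n := by exact_mod_cast (mem_range.mp hi).le
    have h1 : (q i:ℝ) ≤ 2^(i+5) := by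
      have : q i ≤ 2^(i+5) := by have := hq2 i; rw [show 2^(i+5) = 2*2^(i+4) by ring]; exact this
      exact_mod_cast this
    have h2 := Real.log_le_log (by exact_mod_cast (hq i).pos) h1
    rw [Real.log_pow] at h2
    push_cast at h2
    have h3 : Real.log 2 ≤ 1 := by linarith [Real.log_two_lt_d9]
    nlinarith

lemma growth : ∃ U : ℕ, ∀ u, U ≤ u → 32 * ((100:ℝ)*u^2)^46 ≤ 2^u := by
  have h := tendsto_pow_const_div_const_pow_of_one_lt 92 (show (1:ℝ) < 2 by norm_num)
  have h2 := h.eventually (gt_mem_nhds (show (0:ℝ) < 1/(32*100^46) by positivity))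
  obtain ⟨U, hU⟩ := Filter.eventually_atTop.mp h2
  refine ⟨U, fun u hu => ?_⟩
  have h3 := hU u hu
  rw [div_lt_div_iff₀ (by positivity) (by positivity)] at h3
  have e : 32 * ((100:ℝ)*u^2)^46 = u^92 * (32*100^46) := by ring
  rw [e]; linarith

lemma log_prod_le' {S : Finset ℕ} (hS : ∀ q ∈ S, q.Prime) {c : ℝ} (h : ∀ q ∈ S, Real.log q ≤ c) :
    Real.log ((∏ q ∈ S, q : ℕ):ℝ) ≤ S.card * c := by
  push_cast
  rw [Real.log_prod (fun q hq => by exact_mod_cast (hS q hq).ne_zero)]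
  refine (Finset.sum_le_card_nsmul _ _ c h).trans ?_
  rw [nsmul_eq_mul]

lemma stage1 : ∃ U : ℕ, 1 ≤ U ∧ ∀ u, U ≤ u → ∀ l : ℕ, l = 100*u^2 → ∃ M : ℕ, 1 ≤ M ∧ Real.log M ≤ (l:ℝ)^23 ∧
    ∃ S : Finset ℕ, S.card = 2*(4*l^24) ∧ (∀ q ∈ S, q.Prime) ∧ ∑ q ∈ S, 1/((q:ℝ)-1) ≤ 1/4 ∧
      ∀ q ∈ S, q - 1 ∣ M ∧ Real.log q ≤ (l:ℝ)^23 := by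
  obtain ⟨l0, hl0, hQ⟩ := lemQ
  obtain ⟨U, hU⟩ := growth
  refine ⟨max (max 1 U) ⌈l0⌉₊, by simp, ?_⟩
  intro u hu l hl
  have hu1 : 1 ≤ u := (le_max_left _ _).trans ((le_max_left _ _).trans hu)
  have huU : U ≤ u := (le_max_right _ _).trans ((le_max_left _ _).trans hu)
  have hul : l0 ≤ u := (Nat.le_ceil _).trans (by exact_mod_cast (le_max_right _ _).trans hu)
  have hg := hU u huU
  have hlr : (l:ℝ) = 100*u^2 := by rw [hl]; push_cast; ring
  rw [← hlr] at hg
  have hu1r : (1:ℝ) ≤ u := by exact_mod_cast hu1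
  have hl100 : (100:ℝ) ≤ l := by rw [hlr]; nlinarith
  have hll0 : l0 ≤ l := by rw [hlr]; nlinarith
  obtain ⟨S, hSc, hSp, hSs, hSl⟩ := bert (8*u)
  push_cast at hSl
  obtain ⟨S', hS', hS'c, k, hk, -, hklog, hcount⟩ := hQ l hll0 S (4*u) u (by rw [hSc]; ring) (by omega) hSp hSs (by
    intro q hq
    have := hSl q hq
    calc ((u:ℝ)+1) * Real.log q ≤ (u+1) * (8*u+5) := by gcongr
      _ ≤ l := by rw [hlr]; nlinarith)
  have hS'p : ∀ q ∈ S', q.Prime := fun q hq => hSp q (hS' hq)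
  set 𝒯 := (S'.powersetCard u).filter fun T => ((∏ q ∈ T, q)*k+1).Prime with h𝒯
  have hP0 : 1 ≤ ∏ q ∈ S', q := Finset.prod_pos fun q hq => (hS'p q hq).pos
  have hprodlog : Real.log ((∏ q ∈ S', q : ℕ):ℝ) ≤ l := by
    refine (log_prod_le' hS'p (fun q hq => hSl q (hS' hq))).trans ?_
    rw [hS'c, hlr]; push_cast; nlinarith
  have hMlog : Real.log (((∏ q ∈ S', q)*k : ℕ):ℝ) ≤ l + (l:ℝ)^22 := by
    rw [Nat.cast_mul, Real.log_mul (by exact_mod_cast (by omega)) (by exact_mod_cast (by omega))]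
    linarith
  have h23 : (l:ℝ) + (l:ℝ)^22 + 1 ≤ (l:ℝ)^23 := by
    have h1 : (l:ℝ) ≤ (l:ℝ)^22 := le_self_pow₀ (by linarith) (by norm_num)
    have : (l:ℝ)^23 = l * (l:ℝ)^22 := by ring
    rw [this]; nlinarith
  -- the primes
  have hcard : 2*(4*l^24) ≤ (𝒯.image fun T => (∏ q ∈ T, q)*k+1).card := by
    rw [card_image_of_injOn ((prod_inj hS'p hk).mono (by exact_mod_cast filter_subset _ _))]
    have h1 : (3:ℝ)^u ≤ (4*u).choose u := by exact_mod_cast choose_lb u hu1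
    have h2 : (2:ℝ)^u ≤ 3^u := by gcongr; norm_num
    have h3 : (l:ℝ)^22 * (32 * (l:ℝ)^24) ≤ (l:ℝ)^22 * 𝒯.card := by
      calc _ = 32 * (l:ℝ)^46 := by ring
        _ ≤ _ := hg.trans (h2.trans (h1.trans hcount))
    have h4 := le_of_mul_le_mul_left h3 (by positivity)
    have h5 : 32 * l^24 ≤ 𝒯.card := by exact_mod_cast h4
    omega
  obtain ⟨R, hR, hRc⟩ := exists_subset_card_eq hcard
  have hRp : ∀ q ∈ R, ∃ T ∈ S'.powersetCard u, q = (∏ q ∈ T, q)*k+1 ∧ q.Prime := by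
    intro q hq
    obtain ⟨T, hT, rfl⟩ := mem_image.mp (hR hq)
    obtain ⟨h1, h2⟩ := mem_filter.mp hT
    exact ⟨T, h1, rfl, h2⟩
  refine ⟨(∏ q ∈ S', q)*k, Nat.mul_pos hP0 hk, by linarith, R, hRc, ?_, ?_, ?_⟩
  · intro q hq
    obtain ⟨T, -, -, h⟩ := hRp q hq
    exact h
  · have h1 : ∀ q ∈ R, 1/((q:ℝ)-1) ≤ 1/2^u := by
      intro q hq
      obtain ⟨T, hT, he, -⟩ := hRp q hq
      obtain ⟨hT1, hT2⟩ := mem_powersetCard.mp hT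
      have h1 : 2^u ≤ ∏ q ∈ T, q := by
        rw [← hT2]
        exact pow_card_le_prod T _ 2 fun q hq => (hS'p q (hT1 hq)).two_le
      have h2 : 2^u + 1 ≤ q := by rw [he]; nlinarith
      have h3 : (2:ℝ)^u + 1 ≤ q := by exact_mod_cast h2
      exact one_div_le_one_div_of_le (by positivity) (by linarith)
    refine (sum_le_card_nsmul _ _ _ h1).trans ?_
    rw [hRc, nsmul_eq_mul, mul_one_div, div_le_iff₀ (by positivity)]
    push_cast
    have : (l:ℝ)^24 ≤ (l:ℝ)^46 := pow_le_pow_right₀ (by linarith) (by norm_num)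
    linarith
  · intro q hq
    obtain ⟨T, hT, he, hqp⟩ := hRp q hq
    obtain ⟨hT1, hT2⟩ := mem_powersetCard.mp hT
    have hdv : (∏ q ∈ T, q)*k ∣ (∏ q ∈ S', q)*k := Nat.mul_dvd_mul_right (prod_dvd_prod_of_subset _ _ _ hT1) k
    refine ⟨by rw [he, Nat.add_sub_cancel]; exact hdv, ?_⟩
    have hle := Nat.le_of_dvd (Nat.mul_pos hP0 hk) hdv
    have hM1 := Nat.mul_pos hP0 hk
    have h1 : q ≤ 2 * ((∏ q ∈ S', q)*k) := by omega
    have h2 : (q:ℝ) ≤ 2 * (((∏ q ∈ S', q)*k : ℕ):ℝ) := by exact_mod_cast h1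
    have h3 := Real.log_le_log (by exact_mod_cast hqp.pos) h2
    rw [Real.log_mul (by norm_num) (by exact_mod_cast hM1.ne')] at h3
    linarith [Real.log_two_lt_d9]

lemma stage2 : ∃ U : ℕ, ∀ u, U ≤ u → ∃ n, IsCarmichael n ∧ 1 < n.primeFactors.card ∧
    ¬ (n.primeFactors.card).Prime ∧ u < n := by
  obtain ⟨l0, hl0, hQ⟩ := lemQ
  obtain ⟨U, hU1, hU⟩ := stage1
  refine ⟨max (max 20 U) ⌈l0⌉₊, ?_⟩
  intro u hu
  have hu1 : 20 ≤ u := (le_max_left _ _).trans ((le_max_left _ _).trans hu)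
  have huU : U ≤ u := (le_max_right _ _).trans ((le_max_left _ _).trans hu)
  have hul : l0 ≤ u := (Nat.le_ceil _).trans (by exact_mod_cast (le_max_right _ _).trans hu)
  obtain ⟨l, hl⟩ : ∃ l, l = 100*u^2 := ⟨_, rfl⟩
  obtain ⟨M, hM1, hMlog, S, hSc, hSp, hSs, hSl⟩ := hU u huU l hl
  have hul' : u ≤ l := by rw [hl]; nlinarith
  have hl2000 : (2000:ℝ) ≤ l := by
    have : 2000 ≤ l := by rw [hl]; nlinarith
    exact_mod_cast this
  have hl1 : (1:ℝ) ≤ l := by linarith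
  have hlp : (0:ℝ) < l := by linarith
  have hll0 : l0 ≤ (l:ℝ)^48 := by
    calc l0 ≤ u := hul
      _ ≤ l := by exact_mod_cast hul'
      _ ≤ (l:ℝ)^48 := le_self_pow₀ hl1 (by norm_num)
  have h24 : (1:ℝ) ≤ (l:ℝ)^24 := one_le_pow₀ hl1
  have h23 : (1:ℝ) ≤ (l:ℝ)^23 := one_le_pow₀ hl1
  have h47 : (1:ℝ) ≤ (l:ℝ)^47 := one_le_pow₀ hl1
  have h48 : (l:ℝ)^48 = l * (l:ℝ)^47 := by ring
  have h47' : (l:ℝ)^24 * (l:ℝ)^23 = (l:ℝ)^47 := by ring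
  obtain ⟨S', hS', hS'c, k, hk, hkS, -, hcount⟩ := hQ ((l:ℝ)^48) hll0 S (4*l^24) (l^24) hSc (by omega) hSp hSs (by
    intro q hq
    have := (hSl q hq).2
    calc (((l^24:ℕ):ℝ)+1) * Real.log q ≤ (((l^24:ℕ):ℝ)+1) * (l:ℝ)^23 := by gcongr
      _ ≤ (l:ℝ)^48 := by push_cast; nlinarith)
  have hS'p : ∀ q ∈ S', q.Prime := fun q hq => hSp q (hS' hq)
  have hP0 : 1 ≤ ∏ q ∈ S', q := Finset.prod_pos fun q hq => (hS'p q hq).pos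
  have hLlog : Real.log (4*(∏ q ∈ S', q : ℕ)) ≤ (l:ℝ)^48 := by
    rw [Real.log_mul (by norm_num) (by exact_mod_cast (by omega))]
    have h1 := log_prod_le' hS'p (fun q hq => (hSl q (hS' hq)).2)
    rw [hS'c] at h1
    push_cast at h1 ⊢
    have h4 : Real.log 4 ≤ 3 := by
      have := Real.log_le_sub_one_of_pos (show (0:ℝ) < 4 by norm_num); linarith
    nlinarith
  have hMe : (M:ℝ) ≤ Real.exp ((l:ℝ)^23) := (Real.log_le_iff_le_exp (by exact_mod_cast hM1)).mp hMlog
  set C := ((S'.powersetCard (l^24)).filter fun T => ((∏ q ∈ T, q)*k+1).Prime).card with hC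
  have hexp1 : 1 ≤ Real.exp ((l:ℝ)^23) := Real.one_le_exp (by positivity)
  have hLnn : 0 ≤ Real.log (4*((∏ q ∈ S', q : ℕ):ℝ)) := Real.log_nonneg (by
    have : (1:ℝ) ≤ ((∏ q ∈ S', q : ℕ):ℝ) := by exact_mod_cast hP0
    linarith)
  have hkey : 4 * M * Real.log (4*(∏ q ∈ S', q : ℕ)) + S'.card < C := by
    have hub : 4 * M * Real.log (4*(∏ q ∈ S', q : ℕ)) + S'.card ≤ 5 * (l:ℝ)^48 * Real.exp ((l:ℝ)^23) := by
      have h1 : 4 * M * Real.log (4*(∏ q ∈ S', q : ℕ)) ≤ 4 * Real.exp ((l:ℝ)^23) * (l:ℝ)^48 := by gcongr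
      have h2 : (S'.card:ℝ) ≤ (l:ℝ)^48 := by
        rw [hS'c]; push_cast
        have : (l:ℝ)^24 ≤ (l:ℝ)^47 := pow_le_pow_right₀ hl1 (by norm_num)
        nlinarith
      have h3 : (l:ℝ)^48 ≤ (l:ℝ)^48 * Real.exp ((l:ℝ)^23) := le_mul_of_one_le_right (by positivity) hexp1
      nlinarith
    refine lt_of_le_of_lt hub ?_
    have hch : (3:ℝ)^(l^24) ≤ ((l:ℝ)^48)^22 * C := by
      refine le_trans ?_ hcount
      have := choose_lb (l^24) (Nat.pow_pos (by exact_mod_cast hlp))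
      exact_mod_cast this
    have hlt : ((l:ℝ)^48)^22 * (5 * (l:ℝ)^48 * Real.exp ((l:ℝ)^23)) < 3^(l^24) := by
      have e1 : (l:ℝ) ≤ Real.exp l := by linarith [Real.add_one_le_exp (l:ℝ)]
      have e2 : (5:ℝ) ≤ Real.exp 4 := by linarith [Real.add_one_le_exp (4:ℝ)]
      calc ((l:ℝ)^48)^22 * (5 * (l:ℝ)^48 * Real.exp ((l:ℝ)^23)) = 5 * (l:ℝ)^1104 * Real.exp ((l:ℝ)^23) := by ring
        _ ≤ Real.exp 4 * (Real.exp l)^1104 * Real.exp ((l:ℝ)^23) := by gcongr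
        _ = Real.exp (4 + 1104 * l + (l:ℝ)^23) := by
            rw [Real.exp_add, Real.exp_add, ← Real.exp_nat_mul]; norm_num
        _ < Real.exp ((l^24:ℕ) * 1) := by
            apply Real.exp_lt_exp.mpr
            push_cast
            have h1 : (l:ℝ) ≤ (l:ℝ)^23 := le_self_pow₀ hl1 (by norm_num)
            have h2 : (l:ℝ)^24 = l * (l:ℝ)^23 := by ring
            rw [h2]; nlinarith
        _ = Real.exp 1 ^ (l^24) := by rw [Real.exp_nat_mul]
        _ ≤ 3^(l^24) := by gcongr; linarith [Real.exp_one_lt_d9]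
    exact lt_of_mul_lt_mul_left (hlt.trans_le hch) (by positivity)
  obtain ⟨n, h1, h2, h3, h4⟩ := core hS'p hM1 (fun q hq => (hSl q (hS' hq)).1) hk hkS hkey
  refine ⟨n, h1, h2, h3, ?_⟩
  calc u ≤ l := hul'
    _ ≤ l^24 := Nat.le_self_pow (by norm_num) l
    _ < 2^(l^24) := Nat.lt_two_pow_self
    _ ≤ n := h4
end CInf

theorem infinite_carmichael_composite_omega :
    {n : ℕ | IsCarmichael n ∧ 1 < n.primeFactors.card ∧ ¬ (n.primeFactors.card).Prime}.Infinite := by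
  obtain ⟨U, hU⟩ := CInf.stage2
  apply Set.infinite_of_forall_exists_gt
  intro a
  obtain ⟨n, h1, h2, h3, h4⟩ := hU (max a U) (le_max_right _ _)
  exact ⟨n, ⟨h1, h2, h3⟩, lt_of_le_of_lt (le_max_left _ _) h4⟩
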